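/- arXiv:2504.20269 — 2 statements merged into one kernel-verified Lean document; each statement's English description precedes it below -/
import Mathlib

section
/- Let (X, Σ, μ) be a probability space and φ : X → X an invertible measure-preserving map with h_μ(φ) > 0. Then the Koopman operator T_φ on L²(X) has a countable Lebesgue component. -/
open MeasureTheory

/-- A finite `Σ`-measurable partition of `X`, given as a finite collection of measurable sets
that are pairwise disjoint and cover `X`. -/
def IsMeasPartition {X : Type*} [MeasurableSpace X] (α : Finset (Set X)) : Prop :=
  (∀ A ∈ α, MeasurableSet A) ∧ ((α : Set (Set X)).PairwiseDisjoint id) ∧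
    ⋃ A ∈ α, A = Set.univ

/-- The static entropy `H_μ(α) = ∑_{A ∈ α} -μ(A) log μ(A)` of a finite collection of sets
(sets of measure zero contribute `0`, i.e. are omitted). -/
noncomputable def staticEntropy {X : Type*} [MeasurableSpace X] (μ : MeasureTheory.Measure X)
    (α : Finset (Set X)) : ℝ :=
  ∑ A ∈ α, Real.negMulLog (μ A).toReal

/-- The common refinement `⋁_{k=0}^{n-1} φ^{-k}(α)`: its cells are the nonempty intersections
`⋂_{k<n} φ^{-k}(A_k)` over all choices `(A_k) ∈ α^n`. -/
noncomputable def refinePartition {X : Type*} (φ : X → X) (α : Finset (Set X)) (n : ℕ) :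
    Finset (Set X) :=
  @Finset.image _ _ (Classical.decEq _)
    (fun c : Fin n → {A // A ∈ α} => ⋂ k : Fin n, φ^[(k : ℕ)] ⁻¹' ((c k : Set X)))
    Finset.univ

/-- The measure-theoretic entropy
`h_μ(φ, α) = lim_{n → ∞} (1/n) H_μ(⋁_{k=0}^{n-1} φ^{-k}(α))` of a finite partition `α` with
respect to `φ` (the limit exists by subadditivity, so it coincides with the limit superior
used here). -/
noncomputable def partitionEntropy {X : Type*} [MeasurableSpace X]
    (μ : MeasureTheory.Measure X) (φ : X → X) (α : Finset (Set X)) : ℝ :=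
  Filter.limsup (fun n : ℕ => staticEntropy μ (refinePartition φ α n) / n) Filter.atTop

/-- The measure-theoretic entropy `h_μ(φ) = sup_α h_μ(φ, α)`, the supremum (in `[0, ∞]`) over
all finite measurable partitions `α` of `X`. -/
noncomputable def metricEntropy {X : Type*} [MeasurableSpace X] (μ : MeasureTheory.Measure X)
    (φ : X → X) : ENNReal :=
  ⨆ (α : Finset (Set X)) (_ : IsMeasPartition α), ENNReal.ofReal (partitionEntropy μ φ α)

/-- A unitary operator `T` on a Hilbert space has a *countable Lebesgue component* if there is
an orthonormal family `e : ℕ × ℤ → H` with `T (e (n, k)) = e (n, k + 1)`. (Equivalently: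
`H₀ := closed span of the e (n, k)` is a closed separable subspace with `T H₀ = H₀` on which
`T` has countable Lebesgue spectrum, the `xₙ := e (n, 0)` being the orthonormal sequence whose
orbits `(T^k xₙ)_{k ∈ ℤ} = (e (n, k))_{k ∈ ℤ}` are orthonormal bases of the cyclic subspaces
`Z(xₙ; T)` with `H₀ = ⊕ₙ Z(xₙ; T)`.) -/
def HasCountableLebesgueComponent {H : Type*} [NormedAddCommGroup H]
    [InnerProductSpace ℂ H] (T : H → H) : Prop :=
  ∃ e : ℕ × ℤ → H, Orthonormal ℂ e ∧ ∀ (n : ℕ) (k : ℤ), T (e (n, k)) = e (n, k + 1)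


set_option linter.unusedSectionVars false

namespace KLC

/-- one summand of the entropy increment -/
lemma mul_log_le {p m : ℝ} (hp : 0 ≤ p) (hpm : p ≤ m) :
    p * (Real.log m - Real.log p) ≤ 2 * Real.sqrt (p * (m - p)) := by
  rcases hp.eq_or_lt with rfl | hp
  · simp
  have hm : 0 < m := hp.trans_le hpm
  have h1 : Real.log m - Real.log p = 2 * Real.log (Real.sqrt m / Real.sqrt p) := by
    rw [Real.log_div (by positivity) (by positivity), Real.log_sqrt hm.le, Real.log_sqrt hp.le]
    ring
  have h2 := Real.log_le_sub_one_of_pos (x := Real.sqrt m / Real.sqrt p) (by positivity)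
  have h3 : p * (Real.sqrt m / Real.sqrt p - 1) = Real.sqrt p * (Real.sqrt m - Real.sqrt p) := by
    have : Real.sqrt p ≠ 0 := by positivity
    nth_rewrite 1 [← Real.mul_self_sqrt hp.le]
    field_simp
  have h4 : Real.sqrt m - Real.sqrt p ≤ Real.sqrt (m - p) := by
    have h5 := Real.sqrt_nonneg (m - p)
    have h6 := Real.sqrt_nonneg p
    have : Real.sqrt m ≤ Real.sqrt (m - p) + Real.sqrt p := by
      apply Real.sqrt_le_iff.2 ⟨by positivity, ?_⟩
      nlinarith [Real.sq_sqrt hp.le, Real.sq_sqrt (sub_nonneg.2 hpm), mul_nonneg h5 h6]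
    linarith
  rw [h1, Real.sqrt_mul hp.le]
  have := mul_le_mul_of_nonneg_left h4 (Real.sqrt_nonneg p)
  have := mul_le_mul_of_nonneg_left h2 hp.le
  linarith

lemma sum_cons {ι : Type*} [Fintype ι] (n : ℕ) (F : (Fin (n+1) → ι) → ℝ) :
    ∑ c, F c = ∑ c : Fin n → ι, ∑ i, F (Fin.cons i c) := by
  rw [← (Fin.consEquiv (fun _ : Fin (n+1) => ι)).sum_comp, Fintype.sum_prod_type_right]
  rfl

lemma sum_sq_le {ι : Type*} [Fintype ι] [DecidableEq ι] (p : ι → ℝ) (hp : ∀ i, 0 ≤ p i) (i : ι) :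
    2 * (p i * (∑ j, p j - p i)) ≤ (∑ j, p j) ^ 2 - ∑ j, p j ^ 2 := by
  have h1 := Finset.add_sum_erase Finset.univ p (Finset.mem_univ i)
  have h2 := Finset.add_sum_erase Finset.univ (fun j => p j ^ 2) (Finset.mem_univ i)
  have h3 := Finset.sum_sq_le_sq_sum_of_nonneg (s := Finset.univ.erase i) (f := p)
    (fun j _ => hp j)
  rw [← h1, ← h2]
  nlinarith

variable {X : Type*} [MeasurableSpace X]

open Classical in
noncomputable def ind (μ : Measure X) [IsProbabilityMeasure μ] (s : Set X) : Lp ℂ 2 μ :=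
  if h : MeasurableSet s then indicatorConstLp 2 h (measure_ne_top μ s) (1 : ℂ) else 0

lemma coeFn_ind (μ : Measure X) [IsProbabilityMeasure μ] {s : Set X} (hs : MeasurableSet s) :
    (ind μ s : X → ℂ) =ᵐ[μ] s.indicator (fun _ => (1:ℂ)) := by
  rw [ind, dif_pos hs]; exact indicatorConstLp_coeFn

lemma inner_ind (μ : Measure X) [IsProbabilityMeasure μ] {s t : Set X} (hs : MeasurableSet s)
    (ht : MeasurableSet t) : inner ℂ (ind μ s) (ind μ t) = ((μ.real (s ∩ t) : ℝ) : ℂ) := by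
  rw [ind, ind, dif_pos hs, dif_pos ht, L2.inner_indicatorConstLp_indicatorConstLp]
  simp

lemma ind_empty (μ : Measure X) [IsProbabilityMeasure μ] : ind μ (∅ : Set X) = 0 := by
  rw [← inner_self_eq_zero (𝕜 := ℂ), inner_ind μ .empty .empty]; simp

lemma ind_eq_sum (μ : Measure X) [IsProbabilityMeasure μ] {κ : Type*} [Fintype κ]
    (g : X → κ) (hg : ∀ k, MeasurableSet (g ⁻¹' {k})) {s : Set X} (hs : MeasurableSet s) :
    ind μ s = ∑ k, ind μ (s ∩ g ⁻¹' {k}) := by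
  classical
  apply Lp.ext
  refine (coeFn_ind μ hs).trans ?_
  refine .trans ?_ (Lp.coeFn_fun_finsetSum _ _).symm
  have h : ∀ᵐ x ∂μ, ∀ k, (ind μ (s ∩ g ⁻¹' {k}) : X → ℂ) x =
      (s ∩ g ⁻¹' {k}).indicator (fun _ => (1:ℂ)) x :=
    ae_all_iff.2 fun k => coeFn_ind μ (hs.inter (hg k))
  filter_upwards [h] with x hx
  simp only [hx]
  rw [Finset.sum_eq_single (g x)]
  · by_cases h : x ∈ s <;> simp [Set.indicator, h]
  · intro k _ hk
    simp [Set.indicator, hk.symm]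
  · simp

lemma real_eq_sum (μ : Measure X) [IsProbabilityMeasure μ] {κ : Type*} [Fintype κ]
    (g : X → κ) (hg : ∀ k, MeasurableSet (g ⁻¹' {k})) {s : Set X} (hs : MeasurableSet s) :
    μ.real s = ∑ k, μ.real (s ∩ g ⁻¹' {k}) := by
  have h := congrArg (fun v => inner ℂ (ind μ Set.univ) v) (ind_eq_sum μ g hg hs)
  simp only [inner_sum] at h
  rw [inner_ind μ .univ hs, Finset.sum_congr rfl
    (fun k _ => inner_ind μ .univ (hs.inter (hg k)))] at h
  simp only [Set.univ_inter] at h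
  exact_mod_cast h

section Sys

variable {ι : Type*} [Fintype ι] (a : X → ι) (φ : X → X)

def itin (n : ℕ) (x : X) : Fin n → ι := fun k => a (φ^[(k : ℕ)] x)

def cell (n : ℕ) (c : Fin n → ι) : Set X := itin a φ n ⁻¹' {c}

def dcell (n : ℕ) (c : Fin n → ι) : Set X := (itin a φ n ∘ φ) ⁻¹' {c}

lemma itin_succ (n : ℕ) (x : X) : itin a φ (n+1) x = Fin.cons (a x) (itin a φ n (φ x)) := by
  funext k
  refine Fin.cases ?_ (fun k => ?_) k
  · simp [itin]
  · simp [itin]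

lemma itin_le {n m : ℕ} (h : n ≤ m) {x y : X} (hxy : itin a φ m x = itin a φ m y) :
    itin a φ n x = itin a φ n y := by
  funext k
  exact congrFun hxy ⟨k, k.2.trans_le h⟩

lemma cell_cons (n : ℕ) (i : ι) (c : Fin n → ι) :
    cell a φ (n+1) (Fin.cons i c) = a ⁻¹' {i} ∩ dcell a φ n c := by
  ext x
  simp [cell, dcell, itin_succ, Fin.cons_inj]

lemma meas_cell (ha : ∀ i, MeasurableSet (a ⁻¹' {i})) (hφ : Measurable φ) (n : ℕ)
    (c : Fin n → ι) : MeasurableSet (cell a φ n c) := by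
  have : cell a φ n c = ⋂ k : Fin n, φ^[(k : ℕ)] ⁻¹' (a ⁻¹' {c k}) := by
    ext x; simp [cell, itin, funext_iff]
  rw [this]
  exact .iInter fun k => (hφ.iterate k) (ha _)

lemma meas_dcell (ha : ∀ i, MeasurableSet (a ⁻¹' {i})) (hφ : Measurable φ) (n : ℕ)
    (c : Fin n → ι) : MeasurableSet (dcell a φ n c) := hφ (meas_cell a φ ha hφ n c)

lemma dcell_sub {n m : ℕ} (h : n ≤ m) (c : Fin n → ι) (d : Fin m → ι) :
    dcell a φ n c ∩ dcell a φ m d = dcell a φ m d ∨ dcell a φ n c ∩ dcell a φ m d = ∅ := by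
  by_cases hne : (dcell a φ n c ∩ dcell a φ m d).Nonempty
  · left
    obtain ⟨x, hx, hx'⟩ := hne
    apply Set.inter_eq_right.2
    intro y hy
    simp only [dcell, Set.mem_preimage, Function.comp, Set.mem_singleton_iff] at *
    rw [← hx]
    exact itin_le a φ h (hy.trans hx'.symm)
  · right; exact Set.not_nonempty_iff_eq_empty.1 hne

lemma dcell_cell (n : ℕ) (c : Fin n → ι) (d : Fin (n+1) → ι) :
    dcell a φ n c ∩ cell a φ (n+1) d = cell a φ (n+1) d ∨
      dcell a φ n c ∩ cell a φ (n+1) d = ∅ := by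
  by_cases hne : (dcell a φ n c ∩ cell a φ (n+1) d).Nonempty
  · left
    obtain ⟨x, hx, hx'⟩ := hne
    apply Set.inter_eq_right.2
    intro y hy
    simp only [dcell, cell, Set.mem_preimage, Function.comp, Set.mem_singleton_iff] at *
    rw [← hx]
    have := hy.trans hx'.symm
    rw [itin_succ, itin_succ, Fin.cons_inj] at this
    exact this.2
  · right; exact Set.not_nonempty_iff_eq_empty.1 hne

lemma dcell_disj {n : ℕ} {c d : Fin n → ι} (h : c ≠ d) :
    dcell a φ n c ∩ dcell a φ n d = ∅ := by
  ext x
  simp only [dcell, Set.mem_inter_iff, Set.mem_preimage, Set.mem_singleton_iff,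
    Set.mem_empty_iff_false, iff_false, not_and]
  intro h1 h2; exact h (h1.symm.trans h2)

variable (μ : Measure X) [IsProbabilityMeasure μ]

noncomputable def Kn (n : ℕ) : Submodule ℂ (Lp ℂ 2 μ) :=
  Submodule.span ℂ (Set.range fun c => ind μ (dcell a φ n c))

noncomputable def Hn (n : ℕ) : Submodule ℂ (Lp ℂ 2 μ) :=
  Submodule.span ℂ (Set.range fun c => ind μ (cell a φ n c))

noncomputable def KK : Submodule ℂ (Lp ℂ 2 μ) := (⨆ n, Kn a φ μ n).topologicalClosure

noncomputable def HH : Submodule ℂ (Lp ℂ 2 μ) := (⨆ n, Hn a φ μ n).topologicalClosure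

variable (ha : ∀ i, MeasurableSet (a ⁻¹' {i})) (hφ : MeasurePreserving φ μ μ)
include ha hφ

lemma Kn_mono : Monotone (Kn a φ μ) := by
  intro n m h
  refine Submodule.span_le.2 ?_
  rintro _ ⟨c, rfl⟩
  simp only [SetLike.mem_coe]
  rw [ind_eq_sum μ (itin a φ m ∘ φ) (meas_dcell a φ ha hφ.measurable m)
    (meas_dcell a φ ha hφ.measurable n c)]
  refine Submodule.sum_mem _ fun d _ => ?_
  rcases dcell_sub a φ h c d with h' | h'
  · change ind μ (_ ∩ dcell a φ m d) ∈ _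
    rw [h']; exact Submodule.subset_span ⟨d, rfl⟩
  · change ind μ (_ ∩ dcell a φ m d) ∈ _
    rw [h', ind_empty]; exact Submodule.zero_mem _

lemma Kn_le_Hn (n : ℕ) : Kn a φ μ n ≤ Hn a φ μ (n+1) := by
  refine Submodule.span_le.2 ?_
  rintro _ ⟨c, rfl⟩
  simp only [SetLike.mem_coe]
  rw [ind_eq_sum μ (itin a φ (n+1)) (meas_cell a φ ha hφ.measurable (n+1))
    (meas_dcell a φ ha hφ.measurable n c)]
  refine Submodule.sum_mem _ fun d _ => ?_
  rcases dcell_cell a φ n c d with h' | h'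
  · change ind μ (_ ∩ cell a φ (n+1) d) ∈ _
    rw [h']; exact Submodule.subset_span ⟨d, rfl⟩
  · change ind μ (_ ∩ cell a φ (n+1) d) ∈ _
    rw [h', ind_empty]; exact Submodule.zero_mem _

lemma KK_le_HH : KK a φ μ ≤ HH a φ μ :=
  Submodule.topologicalClosure_mono <| iSup_le fun n =>
    (Kn_le_Hn a φ μ ha hφ n).trans (le_iSup (Hn a φ μ) (n+1))

lemma map_HH (T : Lp ℂ 2 μ →L[ℂ] Lp ℂ 2 μ)
    (hT : ∀ f : Lp ℂ 2 μ, (T f : X → ℂ) =ᵐ[μ] (f : X → ℂ) ∘ φ) {f : Lp ℂ 2 μ}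
    (hf : f ∈ HH a φ μ) : T f ∈ KK a φ μ := by
  have hcl : HH a φ μ ≤ (KK a φ μ).comap (T : Lp ℂ 2 μ →ₗ[ℂ] Lp ℂ 2 μ) := by
    refine Submodule.topologicalClosure_minimal _ (iSup_le fun n => Submodule.span_le.2 ?_) ?_
    · rintro _ ⟨c, rfl⟩
      have : T (ind μ (cell a φ n c)) = ind μ (dcell a φ n c) := by
        apply Lp.ext
        refine (hT _).trans ?_
        refine (hφ.quasiMeasurePreserving.ae_eq
          (coeFn_ind μ (meas_cell a φ ha hφ.measurable n c))).trans ?_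
        exact (coeFn_ind μ (meas_dcell a φ ha hφ.measurable n c)).symm
      change T _ ∈ KK a φ μ
      rw [this]
      exact Submodule.le_topologicalClosure _
        (Submodule.mem_iSup_of_mem n (Submodule.subset_span ⟨c, rfl⟩))
    · exact (Submodule.isClosed_topologicalClosure _).preimage T.continuous
  exact hcl hf

lemma real_dcell (n : ℕ) (c : Fin n → ι) : μ.real (dcell a φ n c) = μ.real (cell a φ n c) :=
  hφ.measureReal_preimage (meas_cell a φ ha hφ.measurable n c).nullMeasurableSet

/-- the squared distance of the indicator of `a = i` to the level `n` space -/
noncomputable def Vn (n : ℕ) (i : ι) : ℝ :=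
  ∑ c : Fin n → ι, (μ.real (a ⁻¹' {i} ∩ dcell a φ n c) -
    μ.real (a ⁻¹' {i} ∩ dcell a φ n c) ^ 2 / μ.real (dcell a φ n c))

lemma Vn_le (n : ℕ) (i : ι) {v : Lp ℂ 2 μ} (hv : v ∈ Kn a φ μ n) :
    Vn a φ μ n i ≤ ‖ind μ (a ⁻¹' {i}) - v‖ ^ 2 := by
  classical
  have hD := meas_dcell a φ ha hφ.measurable n
  set p : (Fin n → ι) → ℝ := fun c => μ.real (a ⁻¹' {i} ∩ dcell a φ n c) with hp
  set m : (Fin n → ι) → ℝ := fun c => μ.real (dcell a φ n c) with hm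
  set q : Lp ℂ 2 μ := ∑ c, ((p c / m c : ℝ) : ℂ) • ind μ (dcell a φ n c) with hq
  have hpm : ∀ c, p c ≤ m c := fun c => measureReal_mono Set.inter_subset_right
  have hp0 : ∀ c, 0 ≤ p c := fun c => measureReal_nonneg
  have hdiv : ∀ c, p c / m c * m c = p c := by
    intro c
    by_cases h : m c = 0
    · have : p c = 0 := le_antisymm (h ▸ hpm c) (hp0 c)
      simp [this]
    · field_simp
  have hqmem : q ∈ Kn a φ μ n :=
    Submodule.sum_mem _ fun c _ => Submodule.smul_mem _ _ (Submodule.subset_span ⟨c, rfl⟩)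
  have horth : ∀ c, inner ℂ (ind μ (dcell a φ n c)) (ind μ (a ⁻¹' {i}) - q) = 0 := by
    intro c
    rw [inner_sub_right, inner_ind μ (hD c) (ha i), hq, inner_sum, Finset.sum_eq_single c]
    · rw [inner_smul_right, inner_ind μ (hD c) (hD c), Set.inter_self, ← Complex.ofReal_mul,
        hdiv c, Set.inter_comm, sub_self]
    · intro d _ hd
      rw [inner_smul_right, inner_ind μ (hD c) (hD d), dcell_disj a φ hd.symm]
      simp
    · simp
  have horth' : ∀ w ∈ Kn a φ μ n, inner ℂ w (ind μ (a ⁻¹' {i}) - q) = 0 := by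
    intro w hw
    have : ind μ (a ⁻¹' {i}) - q ∈ (Kn a φ μ n)ᗮ := by
      rw [Submodule.mem_orthogonal]
      intro u hu
      induction hu using Submodule.span_induction with
      | mem x h => obtain ⟨c, rfl⟩ := h; exact horth c
      | zero => simp
      | add x y _ _ hx hy => rw [inner_add_left, hx, hy, add_zero]
      | smul r x _ hx => rw [inner_smul_left, hx, mul_zero]
    exact (Submodule.mem_orthogonal _ _).1 this w hw
  have hnorm : ‖ind μ (a ⁻¹' {i}) - q‖ ^ 2 = Vn a φ μ n i := by
    have h1 : inner ℂ (ind μ (a ⁻¹' {i}) - q) (ind μ (a ⁻¹' {i}) - q) =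
        ((Vn a φ μ n i : ℝ) : ℂ) := by
      rw [inner_sub_left, horth' q hqmem, sub_zero, inner_sub_right, inner_ind μ (ha i) (ha i),
        hq, inner_sum, Set.inter_self,
        real_eq_sum μ (itin a φ n ∘ φ) (meas_dcell a φ ha hφ.measurable n) (ha i)]
      have : ∀ c, inner ℂ (ind μ (a ⁻¹' {i})) (((p c / m c : ℝ) : ℂ) • ind μ (dcell a φ n c)) =
          ((p c ^ 2 / m c : ℝ) : ℂ) := by
        intro c
        rw [inner_smul_right, inner_ind μ (ha i) (hD c), ← Complex.ofReal_mul]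
        congr 1
        change p c / m c * p c = _
        ring
      simp only [this]
      rw [← Complex.ofReal_sum, ← Complex.ofReal_sub, ← Finset.sum_sub_distrib]
      rfl
    rw [← inner_self_eq_norm_sq (𝕜 := ℂ), h1]
    simp
  have hdec : ind μ (a ⁻¹' {i}) - v = (q - v) + (ind μ (a ⁻¹' {i}) - q) := by abel
  rw [hdec, norm_add_sq (𝕜 := ℂ), horth' (q - v) (Submodule.sub_mem _ hqmem hv), hnorm]
  simp

lemma Vn_nonneg (n : ℕ) (i : ι) : 0 ≤ Vn a φ μ n i := by
  refine Finset.sum_nonneg fun c _ => ?_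
  have hpm : μ.real (a ⁻¹' {i} ∩ dcell a φ n c) ≤ μ.real (dcell a φ n c) :=
    measureReal_mono Set.inter_subset_right
  have hp0 : 0 ≤ μ.real (a ⁻¹' {i} ∩ dcell a φ n c) := measureReal_nonneg
  rw [sub_nonneg]
  apply div_le_of_le_mul₀ measureReal_nonneg hp0
  nlinarith

lemma Vn_tendsto (i : ι) (h : ind μ (a ⁻¹' {i}) ∈ KK a φ μ) :
    Filter.Tendsto (fun n => Vn a φ μ n i) Filter.atTop (nhds 0) := by
  rw [Metric.tendsto_atTop]
  intro ε hε
  have h' : ind μ (a ⁻¹' {i}) ∈ closure ((⨆ n, Kn a φ μ n : Submodule ℂ (Lp ℂ 2 μ)) : Set _) := h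
  obtain ⟨v, hv, hd⟩ := Metric.mem_closure_iff.1 h' (Real.sqrt ε) (by positivity)
  have hv' : v ∈ ⨆ n, Kn a φ μ n := hv
  rw [Submodule.mem_iSup_of_directed _ (Kn_mono a φ μ ha hφ).directed_le] at hv'
  obtain ⟨N, hN⟩ := hv'
  refine ⟨N, fun n hn => ?_⟩
  have h1 := Vn_le a φ μ ha hφ n i (Kn_mono a φ μ ha hφ hn hN)
  have h0 := Vn_nonneg a φ μ ha hφ n i
  rw [Real.dist_eq, sub_zero, abs_of_nonneg h0]
  rw [dist_eq_norm] at hd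
  calc _ ≤ _ := h1
    _ < Real.sqrt ε ^ 2 := by gcongr
    _ = ε := Real.sq_sqrt hε.le

noncomputable def En (n : ℕ) : ℝ := ∑ c : Fin n → ι, Real.negMulLog (μ.real (cell a φ n c))

lemma En_succ (n : ℕ) : En a φ μ (n+1) - En a φ μ n ≤ ∑ i, 2 * Real.sqrt (Vn a φ μ n i) := by
  have hD := meas_dcell a φ ha hφ.measurable n
  set p : ι → (Fin n → ι) → ℝ := fun i c => μ.real (a ⁻¹' {i} ∩ dcell a φ n c) with hp
  set m : (Fin n → ι) → ℝ := fun c => μ.real (dcell a φ n c) with hm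
  have hpm : ∀ i c, p i c ≤ m c := fun i c => measureReal_mono Set.inter_subset_right
  have hp0 : ∀ i c, 0 ≤ p i c := fun i c => measureReal_nonneg
  have hm0 : ∀ c, 0 ≤ m c := fun c => measureReal_nonneg
  have hsum : ∀ c, m c = ∑ i, p i c := by
    intro c
    simp only [hm, hp, Set.inter_comm]
    rw [real_eq_sum μ a ha (hD c)]
  have h1 : En a φ μ (n+1) = ∑ c, ∑ i, Real.negMulLog (p i c) := by
    rw [En, sum_cons]
    simp only [cell_cons, hp]
  have h2 : En a φ μ n = ∑ c, Real.negMulLog (m c) := by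
    simp only [En, hm, real_dcell a φ μ ha hφ]
  have h3 : ∑ c, m c = 1 := by
    have := real_eq_sum μ (itin a φ n ∘ φ) hD .univ
    simp only [Set.univ_inter, probReal_univ] at this
    exact this.symm
  have h4 : En a φ μ (n+1) - En a φ μ n ≤ ∑ c, ∑ i, 2 * Real.sqrt (p i c * (m c - p i c)) := by
    rw [h1, h2, ← Finset.sum_sub_distrib]
    refine Finset.sum_le_sum fun c _ => ?_
    calc _ = ∑ i, p i c * (Real.log (m c) - Real.log (p i c)) := by
          simp only [Real.negMulLog]
          nth_rewrite 1 [hsum c]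
          rw [neg_mul, Finset.sum_mul, sub_neg_eq_add, ← Finset.sum_add_distrib]
          exact Finset.sum_congr rfl fun i _ => by ring
      _ ≤ _ := Finset.sum_le_sum fun i _ => mul_log_le (hp0 i c) (hpm i c)
  refine h4.trans ?_
  rw [Finset.sum_comm]
  refine Finset.sum_le_sum fun i _ => ?_
  rw [← Finset.mul_sum]
  refine mul_le_mul_of_nonneg_left ?_ zero_le_two
  apply Real.le_sqrt_of_sq_le
  have hx : ∀ c, 0 ≤ p i c - p i c ^ 2 / m c := by
    intro c
    rw [sub_nonneg]
    apply div_le_of_le_mul₀ (hm0 c) (hp0 i c)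
    nlinarith [hp0 i c, hpm i c]
  have hcs := Finset.sum_sq_le_sum_mul_sum_of_sq_le_mul Finset.univ
    (r := fun c => Real.sqrt (p i c * (m c - p i c))) (f := m)
    (g := fun c => p i c - p i c ^ 2 / m c) (fun c _ => hm0 c) (fun c _ => hx c)
    (by
      intro c _
      apply le_of_eq
      rw [Real.sq_sqrt (mul_nonneg (hp0 i c) (sub_nonneg.2 (hpm i c)))]
      by_cases h : m c = 0
      · have : p i c = 0 := le_antisymm (h ▸ hpm i c) (hp0 i c)
        simp [this]
      · field_simp)
  rw [h3, one_mul] at hcs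
  exact hcs

lemma En_tendsto (h : ∀ i, ind μ (a ⁻¹' {i}) ∈ KK a φ μ) :
    ∃ u : ℕ → ℝ, Filter.Tendsto u Filter.atTop (nhds 0) ∧ ∀ n, En a φ μ n / n ≤ u n := by
  set w : ℕ → ℝ := fun n => ∑ i, 2 * Real.sqrt (Vn a φ μ n i) with hw
  have hwt : Filter.Tendsto w Filter.atTop (nhds 0) := by
    have : (0:ℝ) = ∑ i : ι, 2 * Real.sqrt 0 := by simp
    rw [this]
    refine tendsto_finsetSum _ fun i _ => ?_
    exact (((Real.continuous_sqrt.tendsto 0).comp (Vn_tendsto a φ μ ha hφ i (h i))).const_mul 2)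
  refine ⟨_, hwt.cesaro, fun n => ?_⟩
  have h0 : En a φ μ 0 = 0 := by
    have : ∀ c, cell a φ 0 c = Set.univ := by
      intro c; ext x; simp [cell, Subsingleton.elim (itin a φ 0 x) c]
    simp [En, this]
  have : En a φ μ n ≤ ∑ k ∈ Finset.range n, w k := by
    have := Finset.sum_range_sub (En a φ μ) n
    rw [h0, sub_zero] at this
    rw [← this]
    exact Finset.sum_le_sum fun k _ => En_succ a φ μ ha hφ k
  rw [div_eq_inv_mul]
  gcongr

omit [Fintype ι] ha hφ in
/-- closed span of the indicators of measurable subsets of `s` -/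
noncomputable def SD (s : Set X) : Submodule ℂ (Lp ℂ 2 μ) :=
  (Submodule.span ℂ {f | ∃ u, MeasurableSet u ∧ u ⊆ s ∧ ind μ u = f}).topologicalClosure

omit [Fintype ι] ha hφ in
lemma ind_mem_SD {s u : Set X} (hu : MeasurableSet u) (h : u ⊆ s) : ind μ u ∈ SD μ s :=
  Submodule.le_topologicalClosure _ (Submodule.subset_span ⟨u, hu, h, rfl⟩)

omit [Fintype ι] ha hφ in
lemma SD_ortho {s t : Set X} (h : s ∩ t = ∅) {f g : Lp ℂ 2 μ} (hf : f ∈ SD μ s)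
    (hg : g ∈ SD μ t) : inner ℂ f g = 0 := by
  have h1 : SD μ s ⟂ SD μ t := by
    unfold SD
    rw [Submodule.isOrtho_iff_le, Submodule.orthogonal_closure]
    refine Submodule.topologicalClosure_minimal _ ?_ (Submodule.isClosed_orthogonal _)
    rw [← Submodule.isOrtho_iff_le, Submodule.isOrtho_span]
    rintro _ ⟨u, hu, hus, rfl⟩ _ ⟨v, hv, hvt, rfl⟩
    have : u ∩ v = ∅ := Set.eq_empty_of_subset_empty (h ▸ Set.inter_subset_inter hus hvt)
    rw [inner_ind μ hu hv, this]; simp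
  exact h1.inner_eq hf hg

omit [Fintype ι] ha hφ in
noncomputable def KD (n : ℕ) (c : Fin n → ι) : Submodule ℂ (Lp ℂ 2 μ) :=
  (Submodule.span ℂ {f | ∃ m, ∃ d : Fin m → ι, dcell a φ m d ⊆ dcell a φ n c ∧
    ind μ (dcell a φ m d) = f}).topologicalClosure

noncomputable instance (n : ℕ) (c : Fin n → ι) : (KD a φ μ n c).HasOrthogonalProjection := by
  have : CompleteSpace (KD a φ μ n c) :=
    (Submodule.isClosed_topologicalClosure _).completeSpace_coe
  infer_instance

noncomputable def fD (n : ℕ) (i : ι) (c : Fin n → ι) : Lp ℂ 2 μ :=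
  ind μ (a ⁻¹' {i} ∩ dcell a φ n c) -
    (KD a φ μ n c).starProjection (ind μ (a ⁻¹' {i} ∩ dcell a φ n c))

lemma KD_le_KK (n : ℕ) (c : Fin n → ι) : KD a φ μ n c ≤ KK a φ μ := by
  refine Submodule.topologicalClosure_mono (Submodule.span_le.2 ?_)
  rintro _ ⟨m, d, -, rfl⟩
  exact Submodule.mem_iSup_of_mem m (Submodule.subset_span ⟨d, rfl⟩)

lemma KD_le_SD (n : ℕ) (c : Fin n → ι) : KD a φ μ n c ≤ SD μ (dcell a φ n c) := by
  refine Submodule.topologicalClosure_mono (Submodule.span_mono ?_)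
  rintro _ ⟨m, d, h, rfl⟩
  exact ⟨_, meas_dcell a φ ha hφ.measurable m d, h, rfl⟩

lemma fD_mem_SD (n : ℕ) (i : ι) (c : Fin n → ι) : fD a φ μ n i c ∈ SD μ (dcell a φ n c) :=
  Submodule.sub_mem _ (ind_mem_SD μ ((ha i).inter (meas_dcell a φ ha hφ.measurable n c))
    Set.inter_subset_right)
    (KD_le_SD a φ μ ha hφ n c (Submodule.starProjection_apply_mem _ _))

lemma fD_mem_HH (n : ℕ) (i : ι) (c : Fin n → ι) : fD a φ μ n i c ∈ HH a φ μ := by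
  refine Submodule.sub_mem _ ?_ (KK_le_HH a φ μ ha hφ
    (KD_le_KK a φ μ ha hφ n c (Submodule.starProjection_apply_mem _ _)))
  rw [← cell_cons]
  exact Submodule.le_topologicalClosure _
    (Submodule.mem_iSup_of_mem (n+1) (Submodule.subset_span ⟨_, rfl⟩))

lemma fD_mem_orth (n : ℕ) (i : ι) (c : Fin n → ι) : fD a φ μ n i c ∈ (KK a φ μ)ᗮ := by
  rw [KK, Submodule.orthogonal_closure]
  have key : (⨆ m, Kn a φ μ m) ≤ (Submodule.span ℂ {fD a φ μ n i c})ᗮ := by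
    refine iSup_le fun m => ?_
    refine (Kn_mono a φ μ ha hφ (le_max_left m n)).trans (Submodule.span_le.2 ?_)
    rintro _ ⟨d, rfl⟩
    simp only [SetLike.mem_coe, Submodule.mem_orthogonal_singleton_iff_inner_right]
    have hD := meas_dcell a φ ha hφ.measurable
    rcases dcell_sub a φ (le_max_right m n) c d with h | h
    · have h1 : ind μ (dcell a φ (max m n) d) ∈ KD a φ μ n c :=
        Submodule.le_topologicalClosure _
          (Submodule.subset_span ⟨_, d, Set.inter_eq_right.1 h, rfl⟩)
      exact Submodule.inner_left_of_mem_orthogonal h1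
        (Submodule.sub_starProjection_mem_orthogonal _)
    · exact SD_ortho μ h (fD_mem_SD a φ μ ha hφ n i c) (ind_mem_SD μ (hD _ d) subset_rfl)
  rw [Submodule.mem_orthogonal']
  intro u hu
  exact (Submodule.mem_orthogonal_singleton_iff_inner_right).1 (key hu)

lemma fD_pairwise (n : ℕ) (i : ι) {c d : Fin n → ι} (h : c ≠ d) :
    inner ℂ (fD a φ μ n i c) (fD a φ μ n i d) = 0 :=
  SD_ortho μ (dcell_disj a φ h) (fD_mem_SD a φ μ ha hφ n i c) (fD_mem_SD a φ μ ha hφ n i d)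

lemma fD_norm (n : ℕ) (i : ι) (c : Fin n → ι) :
    ‖fD a φ μ n i c‖ ^ 2 ≤ μ.real (a ⁻¹' {i} ∩ dcell a φ n c) -
      μ.real (a ⁻¹' {i} ∩ dcell a φ n c) ^ 2 / μ.real (dcell a φ n c) := by
  have hD := meas_dcell a φ ha hφ.measurable n c
  set s := a ⁻¹' {i} ∩ dcell a φ n c with hs
  have hsm : MeasurableSet s := (ha i).inter hD
  set t : ℝ := μ.real s / μ.real (dcell a φ n c) with ht
  have hmem : (t : ℂ) • ind μ (dcell a φ n c) ∈ KD a φ μ n c :=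
    Submodule.smul_mem _ _ (Submodule.le_topologicalClosure _
      (Submodule.subset_span ⟨_, c, subset_rfl, rfl⟩))
  have h1 : ‖fD a φ μ n i c‖ ^ 2 ≤ ‖ind μ s - (t : ℂ) • ind μ (dcell a φ n c)‖ ^ 2 := by
    have hdec : ind μ s - (t : ℂ) • ind μ (dcell a φ n c) = fD a φ μ n i c +
      ((KD a φ μ n c).starProjection (ind μ s) - (t : ℂ) • ind μ (dcell a φ n c)) := by
      simp only [fD]; abel
    have h0 : inner ℂ (fD a φ μ n i c)
        ((KD a φ μ n c).starProjection (ind μ s) - (t : ℂ) • ind μ (dcell a φ n c)) = 0 :=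
      Submodule.inner_left_of_mem_orthogonal
        (Submodule.sub_mem _ (Submodule.starProjection_apply_mem _ _) hmem)
        (Submodule.sub_starProjection_mem_orthogonal _)
    rw [hdec, norm_add_sq (𝕜 := ℂ), h0]
    simp
  refine h1.trans (le_of_eq ?_)
  have hsd : s ∩ dcell a φ n c = s := by rw [hs, Set.inter_assoc, Set.inter_self]
  have hn : ∀ u, MeasurableSet u → ‖ind μ u‖ ^ 2 = μ.real u := by
    intro u hu
    rw [← inner_self_eq_norm_sq (𝕜 := ℂ), inner_ind μ hu hu]; simp
  rw [norm_sub_sq (𝕜 := ℂ), inner_smul_right, inner_ind μ hsm hD, norm_smul, mul_pow, hn _ hsm,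
    hn _ hD, hsd, ← Complex.ofReal_mul]
  simp only [RCLike.re_to_complex, Complex.ofReal_re, Complex.norm_real, Real.norm_eq_abs, sq_abs]
  by_cases h : μ.real (dcell a φ n c) = 0
  · simp [ht, h]
  · rw [ht]; field_simp; ring

lemma sum_fD (n : ℕ) (i : ι) : ∃ v ∈ KK a φ μ, ∑ c, fD a φ μ n i c = ind μ (a ⁻¹' {i}) - v := by
  refine ⟨∑ c, (KD a φ μ n c).starProjection (ind μ (a ⁻¹' {i} ∩ dcell a φ n c)),
    Submodule.sum_mem _ fun c _ => KD_le_KK a φ μ ha hφ n c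
      (Submodule.starProjection_apply_mem _ _), ?_⟩
  simp only [fD, Finset.sum_sub_distrib]
  rw [ind_eq_sum μ (itin a φ n ∘ φ) (meas_dcell a φ ha hφ.measurable n) (ha i)]
  rfl

noncomputable def Sn (n : ℕ) : ℝ := ∑ c : Fin n → ι, μ.real (cell a φ n c) ^ 2

lemma Sn_step (n : ℕ) (i : ι) (c : Fin n → ι) :
    2 * (‖fD a φ μ n i c‖ ^ 2) ^ 2 ≤ Sn a φ μ n - Sn a φ μ (n+1) := by
  classical
  have hD := meas_dcell a φ ha hφ.measurable n
  set p : (Fin n → ι) → ι → ℝ := fun c i => μ.real (a ⁻¹' {i} ∩ dcell a φ n c) with hp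
  set m : (Fin n → ι) → ℝ := fun c => μ.real (dcell a φ n c) with hm
  have hpm : ∀ i c, p c i ≤ m c := fun i c => measureReal_mono Set.inter_subset_right
  have hp0 : ∀ i c, 0 ≤ p c i := fun i c => measureReal_nonneg
  have hm0 : ∀ c, 0 ≤ m c := fun c => measureReal_nonneg
  have hsum : ∀ c, m c = ∑ i, p c i := by
    intro c
    simp only [hm, hp, Set.inter_comm]
    rw [real_eq_sum μ a ha (hD c)]
  have h1 : Sn a φ μ n - Sn a φ μ (n+1) = ∑ c, (m c ^ 2 - ∑ j, p c j ^ 2) := by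
    rw [Sn, Sn, sum_cons, ← Finset.sum_sub_distrib]
    simp only [cell_cons, hp, hm, real_dcell a φ μ ha hφ]
  have hterm : ∀ c j, 2 * (p c j * (m c - p c j)) ≤ m c ^ 2 - ∑ j, p c j ^ 2 := by
    intro c j
    rw [hsum c]
    exact sum_sq_le (p c) (fun j => hp0 j c) j
  have h2 : m c ^ 2 - ∑ j, p c j ^ 2 ≤ Sn a φ μ n - Sn a φ μ (n+1) := by
    rw [h1]
    refine Finset.single_le_sum (f := fun c => m c ^ 2 - ∑ j, p c j ^ 2) (fun d _ => ?_)
      (Finset.mem_univ c)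
    exact (mul_nonneg zero_le_two (mul_nonneg (hp0 i d) (sub_nonneg.2 (hpm i d)))).trans
      (hterm d i)
  refine le_trans ?_ ((hterm c i).trans h2)
  have h3 : ‖fD a φ μ n i c‖ ^ 2 ≤ p c i - p c i ^ 2 / m c := fD_norm a φ μ ha hφ n i c
  have h4 : p c i - p c i ^ 2 / m c ≤ m c := by
    have : 0 ≤ p c i ^ 2 / m c := div_nonneg (sq_nonneg _) (hm0 c)
    linarith [hpm i c]
  have h5 : (p c i - p c i ^ 2 / m c) * m c = p c i * (m c - p c i) := by
    by_cases h : m c = 0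
    · have : p c i = 0 := le_antisymm (h ▸ hpm i c) (hp0 i c)
      simp [this]
    · field_simp
  have h6 : 0 ≤ ‖fD a φ μ n i c‖ ^ 2 := by positivity
  nlinarith [hm0 c]

lemma not_finite (i : ι) (hi : ind μ (a ⁻¹' {i}) ∉ KK a φ μ) :
    ¬ FiniteDimensional ℂ ↥(HH a φ μ ⊓ (KK a φ μ)ᗮ) := by
  classical
  intro hfin
  set W := HH a φ μ ⊓ (KK a φ μ)ᗮ with hW
  set d := Module.finrank ℂ W with hd
  have hcl : IsClosed (KK a φ μ : Set (Lp ℂ 2 μ)) := Submodule.isClosed_topologicalClosure _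
  obtain ⟨ε, hε, hball⟩ := Metric.isOpen_iff.1 hcl.isOpen_compl _ hi
  have hdist : ∀ v ∈ KK a φ μ, ε ≤ ‖ind μ (a ⁻¹' {i}) - v‖ := by
    intro v hv
    by_contra! h
    have : v ∈ Metric.ball (ind μ (a ⁻¹' {i})) ε := by
      rw [Metric.mem_ball, dist_comm, dist_eq_norm]; exact h
    exact hball this hv
  have hmem : ∀ n c, fD a φ μ n i c ∈ W := fun n c =>
    ⟨fD_mem_HH a φ μ ha hφ n i c, fD_mem_orth a φ μ ha hφ n i c⟩
  set δ : ℝ := ε ^ 2 / (d + 1) with hδ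
  have hδ0 : 0 < δ := by positivity
  have hex : ∀ n, ∃ c, δ ≤ ‖fD a φ μ n i c‖ ^ 2 := by
    intro n
    by_contra! hlt
    have hcard : (Finset.univ.filter fun c : Fin n → ι => fD a φ μ n i c ≠ 0).card ≤ d := by
      let b : {c : Fin n → ι // fD a φ μ n i c ≠ 0} → W := fun c => ⟨fD a φ μ n i c, hmem n c⟩
      have hb : LinearIndependent ℂ b := by
        apply linearIndependent_of_ne_zero_of_inner_eq_zero
        · intro c h
          exact c.2 (congrArg Subtype.val h)
        · intro c c' h
          exact fD_pairwise a φ μ ha hφ n i (fun h' => h (Subtype.ext h'))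
      have := hb.fintype_card_le_finrank
      rwa [Fintype.card_subtype] at this
    obtain ⟨v, hv, hsum⟩ := sum_fD a φ μ ha hφ n i
    have h1 : ε ^ 2 ≤ ‖∑ c, fD a φ μ n i c‖ ^ 2 := by
      rw [hsum]; gcongr; exact hdist v hv
    have h2 : ‖∑ c, fD a φ μ n i c‖ ^ 2 = ∑ c, ‖fD a φ μ n i c‖ ^ 2 := by
      rw [← inner_self_eq_norm_sq (𝕜 := ℂ), sum_inner, map_sum]
      refine Finset.sum_congr rfl fun c _ => ?_
      rw [inner_sum, Finset.sum_eq_single c]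
      · exact inner_self_eq_norm_sq _
      · intro c' _ h; exact fD_pairwise a φ μ ha hφ n i h.symm
      · simp
    have h3 : ∑ c, ‖fD a φ μ n i c‖ ^ 2 =
        ∑ c ∈ Finset.univ.filter (fun c : Fin n → ι => fD a φ μ n i c ≠ 0),
          ‖fD a φ μ n i c‖ ^ 2 := by
      rw [Finset.sum_filter]
      refine Finset.sum_congr rfl fun c _ => ?_
      split_ifs with h
      · rfl
      · simp [not_not.1 h]
    have h4 := Finset.sum_le_card_nsmul
      (Finset.univ.filter (fun c : Fin n → ι => fD a φ μ n i c ≠ 0))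
      (fun c => ‖fD a φ μ n i c‖ ^ 2) δ (fun c _ => (hlt c).le)
    rw [nsmul_eq_mul] at h4
    have h5 : ((Finset.univ.filter fun c : Fin n → ι => fD a φ μ n i c ≠ 0).card : ℝ) ≤ d := by
      exact_mod_cast hcard
    have h6 : δ * (d + 1) = ε ^ 2 := by rw [hδ]; field_simp
    nlinarith
  have hstep : ∀ n, Sn a φ μ (n+1) ≤ Sn a φ μ n - 2 * δ ^ 2 := by
    intro n
    obtain ⟨c, hc⟩ := hex n
    have := Sn_step a φ μ ha hφ n i c
    have h2 : δ ^ 2 ≤ (‖fD a φ μ n i c‖ ^ 2) ^ 2 := by gcongr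
    linarith
  have hall : ∀ n : ℕ, Sn a φ μ n ≤ Sn a φ μ 0 - n * (2 * δ ^ 2) := by
    intro n
    induction n with
    | zero => simp
    | succ k ih => have := hstep k; push_cast; linarith
  obtain ⟨N, hN⟩ := exists_nat_gt (Sn a φ μ 0 / (2 * δ ^ 2))
  rw [div_lt_iff₀ (by positivity)] at hN
  have h0 : 0 ≤ Sn a φ μ N := Finset.sum_nonneg fun _ _ => sq_nonneg _
  linarith [hall N]

end Sys

lemma exists_orthonormal {E : Type*} [NormedAddCommGroup E] [InnerProductSpace ℂ E]
    [CompleteSpace E] (h : ¬ FiniteDimensional ℂ E) : ∃ e : ℕ → E, Orthonormal ℂ e := by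
  obtain ⟨w, b, hb⟩ := exists_hilbertBasis ℂ E
  have hw : Infinite w := by
    by_contra hfin
    rw [not_infinite_iff_finite] at hfin
    have := Fintype.ofFinite w
    exact h (b.toOrthonormalBasis.toBasis.finiteDimensional_of_finite)
  exact ⟨_, b.orthonormal.comp _ (Infinite.natEmbedding w).injective⟩

lemma lebesgue_of_wandering {E : Type*} [NormedAddCommGroup E] [InnerProductSpace ℂ E]
    [CompleteSpace E] (U : E ≃ₗᵢ[ℂ] E) (H K : Submodule ℂ E) (hH : IsClosed (H : Set E))
    (hKH : K ≤ H) (hU : ∀ f ∈ H, U f ∈ K) (hinf : ¬ FiniteDimensional ℂ ↥(H ⊓ Kᗮ)) :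
    HasCountableLebesgueComponent (⇑U) := by
  have hcl : IsClosed ((H ⊓ Kᗮ : Submodule ℂ E) : Set E) :=
    hH.inter (Submodule.isClosed_orthogonal K)
  have : CompleteSpace ↥(H ⊓ Kᗮ) := hcl.completeSpace_coe
  obtain ⟨w, hw⟩ := exists_orthonormal hinf
  have hpow : ∀ (j : ℕ) (f : E), f ∈ H → (U ^ (j+1)) f ∈ K := by
    intro j
    induction j with
    | zero => intro f hf; simpa using hU f hf
    | succ j ih =>
      intro f hf
      rw [pow_succ']
      exact hU _ (hKH (ih f hf))
  have horth : ∀ (n m : ℕ) (k l : ℤ), k < l →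
      inner ℂ ((U ^ k) (w n : E)) ((U ^ l) (w m : E)) = 0 := by
    intro n m k l hkl
    obtain ⟨j, hj⟩ := Int.eq_ofNat_of_zero_le (show 0 ≤ l - k - 1 by omega)
    have hl : U ^ l = U ^ k * U ^ (j+1) := by
      rw [← zpow_natCast, ← zpow_add]; congr 1; push_cast; omega
    rw [hl]; change inner ℂ ((U ^ k) (w n : E)) ((U ^ k) ((U ^ (j+1)) (w m : E))) = 0
    rw [LinearIsometryEquiv.inner_map_map]
    exact Submodule.inner_left_of_mem_orthogonal (hpow j _ (w m).2.1) (w n).2.2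
  refine ⟨fun q => (U ^ q.2) (w q.1 : E), ?_, ?_⟩
  · rw [orthonormal_iff_ite] at hw ⊢
    rintro ⟨n, k⟩ ⟨m, l⟩
    simp only
    rcases lt_trichotomy k l with h | h | h
    · rw [horth n m k l h, if_neg]; simp [h.ne]
    · subst h
      rw [LinearIsometryEquiv.inner_map_map]
      have := hw n m
      simpa using this
    · rw [← inner_conj_symm, horth m n l k h, if_neg] <;> simp [h.ne']
  · intro n k
    simp only
    rw [add_comm k 1, zpow_add, zpow_one]; rfl

end KLC

/-- Let `(X, Σ, μ)` be a probability space and `φ : X → X` an invertible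
measure-preserving map with `h_μ(φ) > 0`. Then the Koopman operator `T_φ` on `L²(X)` has a
countable Lebesgue component. -/
theorem stmt11 {X : Type*} [MeasurableSpace X] (μ : Measure X) [IsProbabilityMeasure μ]
    (φ : X → X) (hφ : MeasurePreserving φ μ μ)
    (hinv : ∃ ψ : X → X, MeasurePreserving ψ μ μ ∧
      (∀ᵐ x ∂μ, ψ (φ x) = x) ∧ (∀ᵐ x ∂μ, φ (ψ x) = x))
    (T : Lp ℂ 2 μ →L[ℂ] Lp ℂ 2 μ)
    (hT : ∀ f : Lp ℂ 2 μ, (T f : X → ℂ) =ᵐ[μ] (f : X → ℂ) ∘ φ)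
    (hent : 0 < metricEntropy μ φ) :
    HasCountableLebesgueComponent (⇑T) := by

  classical
  -- choose a partition of positive entropy
  obtain ⟨α, hα, hpos⟩ : ∃ α : Finset (Set X), IsMeasPartition α ∧ 0 < partitionEntropy μ φ α := by
    by_contra! h
    have : metricEntropy μ φ = 0 := by
      simp only [metricEntropy, ENNReal.iSup_eq_zero, ENNReal.ofReal_eq_zero]
      exact h
    exact hent.ne' this
  obtain ⟨hmeas, hdisj, hcov⟩ := hα
  have hex : ∀ x : X, ∃ A : {A // A ∈ α}, x ∈ (A : Set X) := by
    intro x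
    have : x ∈ ⋃ A ∈ α, A := hcov ▸ Set.mem_univ x
    simp only [Set.mem_iUnion] at this
    obtain ⟨A, hA, hx⟩ := this
    exact ⟨⟨A, hA⟩, hx⟩
  choose a hax using hex
  have haA : ∀ A : {A // A ∈ α}, a ⁻¹' {A} = (A : Set X) := by
    intro A
    ext x
    simp only [Set.mem_preimage, Set.mem_singleton_iff]
    constructor
    · rintro rfl; exact hax x
    · intro hx
      by_contra hne
      have h1 : ((a x : Set X)) ≠ A := fun h => hne (Subtype.ext h)
      exact Set.disjoint_left.1 (hdisj (a x).2 A.2 h1) (hax x) hx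
  have ha : ∀ A, MeasurableSet (a ⁻¹' {A}) := fun A => by rw [haA]; exact hmeas _ A.2
  -- some cell is not measurable with respect to the strict future
  obtain ⟨i, hi⟩ : ∃ i, KLC.ind μ (a ⁻¹' {i}) ∉ KLC.KK a φ μ := by
    by_contra! h
    obtain ⟨u, hu, hle⟩ := KLC.En_tendsto a φ μ ha hφ h
    have hlim : Filter.Tendsto (fun n : ℕ => staticEntropy μ (refinePartition φ α n) / n)
        Filter.atTop (nhds 0) := by
      have hnn : ∀ s : Set X, 0 ≤ Real.negMulLog (μ s).toReal := fun s =>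
        Real.negMulLog_nonneg ENNReal.toReal_nonneg (measureReal_le_one (μ := μ) (s := s))
      refine squeeze_zero (fun n => ?_) (fun n => ?_) hu
      · exact div_nonneg (Finset.sum_nonneg fun s _ => hnn s) (Nat.cast_nonneg n)
      · refine le_trans ?_ (hle n)
        gcongr
        have h1 : ∀ c : Fin n → {A // A ∈ α},
            (⋂ k : Fin n, φ^[(k : ℕ)] ⁻¹' ((c k : Set X))) = KLC.cell a φ n c := by
          intro c
          ext x
          simp [← haA, KLC.cell, KLC.itin, funext_iff]
        unfold staticEntropy refinePartition
        refine (@Finset.sum_image_le_of_nonneg _ _ _ _ _ _ (Classical.decEq _) _ _ _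
          (fun s _ => hnn s)).trans (le_of_eq ?_)
        simp only [h1]
        rfl
    rw [partitionEntropy, hlim.limsup_eq] at hpos
    exact lt_irrefl _ hpos
  obtain ⟨ψ, hψ, hψφ, hφψ⟩ := hinv
  have hTeq : ∀ f, T f = Lp.compMeasurePreservingₗᵢ ℂ φ hφ f := fun f =>
    Lp.ext ((hT f).trans (Lp.coeFn_compMeasurePreserving f hφ).symm)
  have hsurj : Function.Surjective (Lp.compMeasurePreservingₗᵢ ℂ φ hφ :
      Lp ℂ 2 μ →ₗᵢ[ℂ] Lp ℂ 2 μ) := by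
    intro g
    refine ⟨Lp.compMeasurePreserving ψ hψ g, ?_⟩
    rw [← hTeq]
    apply Lp.ext
    refine (hT _).trans ?_
    refine (hφ.quasiMeasurePreserving.ae_eq (Lp.coeFn_compMeasurePreserving g hψ)).trans ?_
    filter_upwards [hψφ] with x hx
    simp [hx]
  have hfin := KLC.lebesgue_of_wandering (LinearIsometryEquiv.ofSurjective _ hsurj)
    (KLC.HH a φ μ) (KLC.KK a φ μ) (Submodule.isClosed_topologicalClosure _)
    (KLC.KK_le_HH a φ μ ha hφ)
    (fun f hf => by
      have := KLC.map_HH a φ μ ha hφ T hT hf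
      rw [hTeq] at this
      exact this)
    (KLC.not_finite a φ μ ha hφ i hi)
  have hfun : (⇑T) = ⇑(LinearIsometryEquiv.ofSurjective _ hsurj) := funext hTeq
  rw [hfun]
  exact hfin
end

section
/- Let (X, Σ, μ) be a probability space and φ : X → X an invertible measure-preserving map with h_μ(φ) > 0. Then h_apr(T_φ) = ∞, i.e., the approximation entropy of the Koopman operator T_φ is not bounded by any real number. -/
open MeasureTheory

/-- `H_apr(ω, δ)`: the minimal dimension of a finite-dimensional subspace `F ⊆ H` such that
every `x ∈ ω` is within distance `< δ` of some `y ∈ F`. -/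
noncomputable def Hapr {H : Type*} [NormedAddCommGroup H] [InnerProductSpace ℂ H]
    (ω : Set H) (δ : ℝ) : ℕ :=
  sInf {d : ℕ | ∃ F : Submodule ℂ H, FiniteDimensional ℂ ↥F ∧ Module.finrank ℂ ↥F = d ∧
    ∀ x ∈ ω, ∃ y ∈ F, ‖x - y‖ < δ}

/-- `h_apr(T, ω, δ) = lim_{n → ∞} (1/n) H_apr(⋃_{k=0}^{n-1} T^k ω, δ)` (the limit exists by
subadditivity, hence coincides with the limit superior used here). -/
noncomputable def haprδ {H : Type*} [NormedAddCommGroup H] [InnerProductSpace ℂ H]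
    (T : H → H) (ω : Set H) (δ : ℝ) : ℝ :=
  Filter.limsup (fun n : ℕ => (Hapr (⋃ k < n, T^[k] '' ω) δ : ℝ) / n) Filter.atTop

/-- `h_apr(T, ω) = sup_{δ > 0} h_apr(T, ω, δ)`, the approximation entropy of `ω` with
respect to `T`. -/
noncomputable def haprω {H : Type*} [NormedAddCommGroup H] [InnerProductSpace ℂ H]
    (T : H → H) (ω : Set H) : ℝ :=
  ⨆ (δ : ℝ) (_ : 0 < δ), haprδ T ω δ

/-- `h_apr(T, F)`: the approximation entropy of a subspace `F`, the supremum of `h_apr(T, ω)`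
over all finite subsets `ω ⊆ F`. -/
noncomputable def haprSub {H : Type*} [NormedAddCommGroup H] [InnerProductSpace ℂ H]
    (T : H → H) (F : Submodule ℂ H) : ℝ :=
  ⨆ (ω : Finset H) (_ : (ω : Set H) ⊆ (F : Set H)), haprω T (ω : Set H)


lemma aux_bessel {H : Type*} [NormedAddCommGroup H] [InnerProductSpace ℂ H]
    {ι : Type*} [Fintype ι] (x : ι → H) (hx : Orthonormal ℂ x) (F : Submodule ℂ H)
    [FiniteDimensional ℂ F] (h : ∀ i, ∃ y ∈ F, ‖x i - y‖ < 1 / 2) :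
    (3 / 4 : ℝ) * Fintype.card ι ≤ Module.finrank ℂ F := by
  classical
  let b := stdOrthonormalBasis ℂ F
  have h1 : ∀ i, (3 / 4 : ℝ) ≤ ∑ l, ‖inner ℂ ((b l : F) : H) (x i)‖ ^ 2 := by
    intro i
    obtain ⟨y, hy, hxy⟩ := h i
    set p := F.orthogonalProjectionOnto (x i) with hp
    have e1 : ∑ l, ‖inner ℂ ((b l : F) : H) (x i)‖ ^ 2 = ‖p‖ ^ 2 := by
      rw [← b.sum_sq_norm_inner_right p]
      refine Finset.sum_congr rfl fun l _ => ?_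
      rw [hp, Submodule.inner_orthogonalProjectionOnto_eq_of_mem_left]
    rw [e1]
    have e2 : ‖x i - p‖ ≤ ‖x i - y‖ := by
      have := Submodule.starProjection_minimal (U := F) (x i)
      rw [Submodule.starProjection_apply] at this
      rw [hp, this]
      exact ciInf_le (f := fun z : F => ‖x i - z‖) ⟨0, by rintro _ ⟨z, rfl⟩; positivity⟩ ⟨y, hy⟩
    have e3 : ‖x i‖ ^ 2 = ‖p‖ ^ 2 + ‖x i - p‖ ^ 2 := by
      have := F.norm_sq_eq_add_norm_sq_starProjection (x i)
      rw [Submodule.starProjection_orthogonal_val, Submodule.starProjection_apply] at this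
      exact this
    rw [hx.1 i] at e3
    have : ‖x i - p‖ ≤ 1/2 := by linarith
    nlinarith [norm_nonneg (x i - p)]
  have h2 : ∀ l, ∑ i, ‖inner ℂ ((b l : F) : H) (x i)‖ ^ 2 ≤ 1 := by
    intro l
    have := hx.sum_inner_products_le (x := ((b l : F) : H)) (s := Finset.univ)
    have e : ‖((b l : F) : H)‖ = 1 := b.orthonormal.1 l
    rw [e] at this
    simp_rw [norm_inner_symm ((b l : F) : H)]
    simpa using this
  calc (3 / 4 : ℝ) * Fintype.card ι = ∑ i : ι, (3 / 4 : ℝ) := by simp [mul_comm]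
    _ ≤ ∑ i, ∑ l, ‖inner ℂ ((b l : F) : H) (x i)‖ ^ 2 := Finset.sum_le_sum fun i _ => h1 i
    _ = ∑ l, ∑ i, ‖inner ℂ ((b l : F) : H) (x i)‖ ^ 2 := Finset.sum_comm
    _ ≤ ∑ l : Fin (Module.finrank ℂ F), (1 : ℝ) := Finset.sum_le_sum fun l _ => h2 l
    _ = _ := by simp

lemma aux_weak {H : Type*} [NormedAddCommGroup H] [InnerProductSpace ℂ H]
    (x : ℕ → H) (c : ℝ) (g : ℕ → ℝ) (hx : ∀ j, ‖x j‖ ≤ 1) (hg : Filter.Tendsto g Filter.atTop (nhds 0))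
    (hxx : ∀ i j, RCLike.re (inner ℂ (x i) (x (i + (j + 1)))) = g j)
    (y : H) (hy : ‖y‖ ≤ 1) (hc : 0 < c) (hyx : ∀ j, RCLike.re (inner ℂ y (x j)) = c) : False := by
  have hev : ∀ᶠ j in Filter.atTop, g j < c ^ 2 / 2 := hg.eventually_lt_const (by positivity)
  obtain ⟨J, hJ⟩ := Filter.eventually_atTop.1 hev
  have key : ∀ K : ℕ, ‖∑ k ∈ Finset.range K, x ((J+1) * k)‖ ^ 2 ≤ K + c ^ 2 / 2 * K ^ 2 := by
    intro K
    induction K with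
    | zero => simp
    | succ K ih =>
      rw [Finset.sum_range_succ, norm_add_sq (𝕜 := ℂ)]
      have h1 : RCLike.re (inner ℂ (∑ k ∈ Finset.range K, x ((J+1) * k)) (x ((J+1)*K))) ≤ K * (c^2/2) := by
        rw [sum_inner, map_sum]
        calc _ ≤ ∑ k ∈ Finset.range K, c^2/2 := by
              refine Finset.sum_le_sum fun k hk => ?_
              have hk := Finset.mem_range.1 hk
              obtain ⟨t, rfl⟩ := Nat.exists_eq_add_of_lt hk
              have e : (J+1) * (k + t + 1) = (J+1)*k + ((J + (J+1)*t) + 1) := by ring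
              rw [e, hxx]
              exact (hJ _ (Nat.le_add_right _ _)).le
          _ = _ := by simp
      have h2 := hx ((J+1)*K)
      have h3 : ‖x ((J+1)*K)‖^2 ≤ 1 := pow_le_one₀ (norm_nonneg _) h2
      push_cast
      nlinarith [sq_nonneg c]
  obtain ⟨K, hK⟩ := exists_nat_gt (2 / c ^ 2)
  have h1 : (K : ℝ) * c ≤ ‖∑ k ∈ Finset.range K, x ((J+1) * k)‖ := by
    calc (K : ℝ) * c = RCLike.re (inner ℂ y (∑ k ∈ Finset.range K, x ((J+1) * k))) := by
          rw [inner_sum, map_sum]; simp only [hyx]; simp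
      _ ≤ ‖y‖ * ‖∑ k ∈ Finset.range K, x ((J+1) * k)‖ := re_inner_le_norm _ _
      _ ≤ _ := mul_le_of_le_one_left (norm_nonneg _) hy
  have h2 := key K
  have h3 : ((K : ℝ) * c)^2 ≤ K + c ^ 2 / 2 * K ^ 2 := le_trans (pow_le_pow_left₀ (by positivity) h1 2) h2
  rw [div_lt_iff₀ (by positivity)] at hK
  have hK0 : (0:ℝ) < K := by
    rcases Nat.eq_zero_or_pos K with h | h
    · subst h; simp at hK; linarith
    · exact_mod_cast h
  nlinarith

lemma aux_findim {H : Type*} [NormedAddCommGroup H] [InnerProductSpace ℂ H]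
    (V : Submodule ℂ H) [FiniteDimensional ℂ V] (u : ℕ → H) (hu : ∀ j, u j ∈ V)
    (h : ∀ e : H, Filter.Tendsto (fun j => inner ℂ e (u j)) Filter.atTop (nhds 0)) :
    Filter.Tendsto (fun j => ‖u j‖ ^ 2) Filter.atTop (nhds 0) := by
  let b := stdOrthonormalBasis ℂ V
  have e : ∀ j, ‖u j‖ ^ 2 = ∑ l, ‖inner ℂ ((b l : V) : H) (u j)‖ ^ 2 := by
    intro j
    exact (b.sum_sq_norm_inner_right (⟨u j, hu j⟩ : V)).symm
  simp_rw [e]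
  rw [show (0:ℝ) = ∑ l : Fin (Module.finrank ℂ V), 0 by simp]
  refine tendsto_finsetSum _ fun l _ => ?_
  have := (h (b l)).norm.pow 2
  simpa using this

lemma aux_ortho {H : Type*} [NormedAddCommGroup H] [InnerProductSpace ℂ H]
    (x : ℕ → H) (r : ℝ) (hr : 0 < r) (hn : ∀ j, ‖x j‖ = r)
    (ho : ∀ i j, i ≠ j → inner ℂ (x i) (x j) = 0) (e : H) :
    Filter.Tendsto (fun j => inner ℂ e (x j)) Filter.atTop (nhds 0) := by
  have hon : Orthonormal ℂ (fun j => ((r⁻¹ : ℝ) : ℂ) • x j) := by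
    refine ⟨fun j => ?_, fun i j hij => ?_⟩
    · rw [norm_smul, hn]; simp [abs_of_pos hr, hr.ne']
    · simp [inner_smul_left, inner_smul_right, ho i j hij]
  have hs := (hon.inner_products_summable (x := e)).tendsto_atTop_zero
  have h2 : Filter.Tendsto (fun j => ‖inner ℂ (((r⁻¹ : ℝ) : ℂ) • x j) e‖) Filter.atTop (nhds 0) := by
    have := hs.sqrt
    simp only [Real.sqrt_zero] at this
    refine this.congr fun j => ?_
    rw [Real.sqrt_sq (norm_nonneg _)]
  rw [tendsto_zero_iff_norm_tendsto_zero]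
  have h3 := h2.const_mul r
  refine (h3.congr fun j => ?_).trans (by simp)
  rw [inner_smul_left, norm_mul, norm_inner_symm]
  simp [abs_of_pos hr, hr.ne']

lemma aux_exists_on {H : Type*} [NormedAddCommGroup H] [InnerProductSpace ℂ H]
    (V : Submodule ℂ H) (hV : ¬ FiniteDimensional ℂ V) (m : ℕ) :
    ∃ e : Fin m → H, Orthonormal ℂ e ∧ ∀ i, e i ∈ V := by
  have hr : (m : Cardinal) ≤ Module.rank ℂ V := by
    have : ¬ Module.rank ℂ V < Cardinal.aleph0 := fun h => hV (Module.rank_lt_aleph0_iff.1 h)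
    exact (Cardinal.natCast_lt_aleph0.le).trans (not_lt.1 this)
  obtain ⟨s, hs, hli⟩ := le_rank_iff_exists_linearIndependent_finset.1 hr
  let f : Fin m → V := fun i => ((s.equivFinOfCardEq hs).symm i : V)
  have hf : LinearIndependent ℂ f := hli.comp _ (Equiv.injective _)
  have := InnerProductSpace.gramSchmidtNormed_orthonormal (𝕜 := ℂ) hf
  refine ⟨fun i => (InnerProductSpace.gramSchmidtNormed ℂ f i : V), ?_, fun i => Subtype.property _⟩
  exact this.comp_linearIsometry V.subtypeₗᵢ

lemma aux_iter_inner {H : Type*} [NormedAddCommGroup H] [InnerProductSpace ℂ H]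
    (T : H →L[ℂ] H) (hiso : ∀ f g, inner ℂ (T f) (T g) = inner ℂ f g) (k : ℕ) (f g : H) :
    inner ℂ (T^[k] f) (T^[k] g) = inner ℂ f g := by
  induction k with
  | zero => rfl
  | succ k ih => rw [Function.iterate_succ_apply', Function.iterate_succ_apply', hiso, ih]

lemma aux_on_iter {H : Type*} [NormedAddCommGroup H] [InnerProductSpace ℂ H]
    (T : H →L[ℂ] H) (hiso : ∀ f g, inner ℂ (T f) (T g) = inner ℂ f g)
    {ι : Type*} (e : ι → H) (he : Orthonormal ℂ e)
    (hw : ∀ i j k, inner ℂ (e i) (T^[k+1] (e j)) = 0) :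
    Orthonormal ℂ (fun p : ℕ × ι => T^[p.1] (e p.2)) := by
  have hlt : ∀ k l i j, k < l → inner ℂ (T^[k] (e i)) (T^[l] (e j)) = 0 := by
    intro k l i j hkl
    obtain ⟨t, rfl⟩ := Nat.exists_eq_add_of_lt hkl
    rw [add_assoc, Function.iterate_add_apply, aux_iter_inner T hiso, hw]
  refine ⟨?_, ?_⟩
  · rintro ⟨k, i⟩
    have := aux_iter_inner T hiso k (e i) (e i)
    rw [inner_self_eq_norm_sq_to_K, inner_self_eq_norm_sq_to_K, he.1 i] at this
    have h2 : ‖T^[k] (e i)‖ ^ 2 = 1 := by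
      have h3 := congrArg RCLike.re this
      norm_cast at h3
      simpa using h3
    have := norm_nonneg (T^[k] (e i))
    show ‖T^[k] (e i)‖ = 1
    nlinarith
  · rintro ⟨k, i⟩ ⟨l, j⟩ hne
    show inner ℂ (T^[k] (e i)) (T^[l] (e j)) = 0
    rcases lt_trichotomy k l with h | h | h
    · exact hlt k l i j h
    · subst h
      rw [aux_iter_inner T hiso]
      exact he.2 (fun h => hne (by rw [h]))
    · rw [← inner_conj_symm, hlt l k j i h, map_zero]

lemma aux_hapr {H : Type*} [NormedAddCommGroup H] [InnerProductSpace ℂ H]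
    (T : H →L[ℂ] H) (hiso : ∀ f g, inner ℂ (T f) (T g) = inner ℂ f g)
    (m : ℕ) (e : Fin m → H) (he : Orthonormal ℂ e)
    (hw : ∀ i j k, inner ℂ (e i) (T^[k+1] (e j)) = 0) :
    ∃ ω : Finset H, (3 / 4 : ℝ) * m ≤ haprω (⇑T) (ω : Set H) := by
  classical
  refine ⟨Finset.univ.image e, ?_⟩
  set ω : Set H := ((Finset.univ.image e : Finset H) : Set H) with hω
  have hωr : ω = Set.range e := by simp [hω]
  have hon := aux_on_iter T hiso e he hw
  -- upper bound
  have hex : ∀ n (δ : ℝ), 0 < δ → n * m ∈ {d : ℕ | ∃ F : Submodule ℂ H, FiniteDimensional ℂ ↥F ∧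
      Module.finrank ℂ ↥F = d ∧ ∀ x ∈ ⋃ k < n, T^[k] '' ω, ∃ y ∈ F, ‖x - y‖ < δ} := by
    intro n δ hδ
    let f : Fin n × Fin m → H := fun p => T^[(p.1 : ℕ)] (e p.2)
    have hf : Orthonormal ℂ f := by
      have := hon.comp (fun p : Fin n × Fin m => ((p.1 : ℕ), p.2)) (by
        rintro ⟨a, b⟩ ⟨c, d⟩ h
        simp only [Prod.mk.injEq] at h
        ext
        · exact h.1
        · rw [h.2])
      exact this
    refine ⟨Submodule.span ℂ (Set.range f), FiniteDimensional.span_of_finite ℂ (Set.finite_range f), ?_, ?_⟩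
    · rw [finrank_span_eq_card hf.linearIndependent]; simp
    · intro x hx
      simp only [Set.mem_iUnion, hωr] at hx
      obtain ⟨k, hk, _, ⟨i, rfl⟩, rfl⟩ := hx
      exact ⟨_, Submodule.subset_span ⟨(⟨k, hk⟩, i), rfl⟩, by simpa [f] using hδ⟩
  have hup : ∀ n (δ : ℝ), 0 < δ → (Hapr (⋃ k < n, T^[k] '' ω) δ : ℝ) / n ≤ m := by
    intro n δ hδ
    have h1 : Hapr (⋃ k < n, T^[k] '' ω) δ ≤ n * m := Nat.sInf_le (hex n δ hδ)
    rcases Nat.eq_zero_or_pos n with h | h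
    · subst h; simp
    · rw [div_le_iff₀ (by exact_mod_cast h)]
      rw [mul_comm]; exact_mod_cast h1
  have hbd : ∀ (δ : ℝ), 0 < δ → Filter.IsBoundedUnder (· ≤ ·) Filter.atTop
      (fun n : ℕ => (Hapr (⋃ k < n, T^[k] '' ω) δ : ℝ) / n) := fun δ hδ =>
    ⟨m, Filter.eventually_map.2 (Filter.Eventually.of_forall fun n => hup n δ hδ)⟩
  have hcobd : ∀ (δ : ℝ), Filter.IsCoboundedUnder (· ≤ ·) Filter.atTop
      (fun n : ℕ => (Hapr (⋃ k < n, T^[k] '' ω) δ : ℝ) / n) := fun δ =>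
    Filter.isCoboundedUnder_le_of_le Filter.atTop (x := 0) fun n => by positivity
  have hup2 : ∀ δ : ℝ, (⨆ (_ : 0 < δ), haprδ T ω δ) ≤ m := by
    intro δ
    by_cases hδ : 0 < δ
    · rw [ciSup_pos hδ]
      exact Filter.limsup_le_of_le (hcobd δ) (Filter.Eventually.of_forall fun n => hup n δ hδ)
    · have : IsEmpty (0 < δ) := ⟨hδ⟩
      rw [Real.iSup_of_isEmpty]; positivity
  have hlow : (3 / 4 : ℝ) * m ≤ haprδ T ω (1/2) := by
    refine Filter.le_limsup_of_frequently_le (Filter.Eventually.frequently ?_) (hbd _ (by norm_num))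
    filter_upwards [Filter.eventually_gt_atTop 0] with n hn
    rw [le_div_iff₀ (by exact_mod_cast hn)]
    obtain ⟨F, hF, hd, hx⟩ := Nat.sInf_mem ⟨_, hex n (1/2) (by norm_num)⟩
    have hd' : Module.finrank ℂ F = Hapr (⋃ k < n, T^[k] '' ω) (1/2) := hd
    rw [← hd']
    have hf : Orthonormal ℂ (fun p : Fin n × Fin m => T^[(p.1 : ℕ)] (e p.2)) := by
      have := hon.comp (fun p : Fin n × Fin m => ((p.1 : ℕ), p.2)) (by
        rintro ⟨a, b⟩ ⟨c, d⟩ h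
        simp only [Prod.mk.injEq] at h
        ext
        · exact h.1
        · rw [h.2])
      exact this
    have := aux_bessel _ hf F (fun p => hx _ (by
      simp only [Set.mem_iUnion, hωr]
      exact ⟨p.1, p.1.2, _, ⟨p.2, rfl⟩, rfl⟩))
    simp only [Fintype.card_prod, Fintype.card_fin] at this
    push_cast at this
    linarith
  refine hlow.trans ?_
  have h3 := le_ciSup (f := fun δ : ℝ => ⨆ (_ : 0 < δ), haprδ T ω δ)
    ⟨m, by rintro _ ⟨δ, rfl⟩; exact hup2 δ⟩ (1/2 : ℝ)
  have h4 : (⨆ (_ : (0:ℝ) < 1/2), haprδ T ω (1/2)) = haprδ T ω (1/2) := ciSup_pos (by norm_num)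
  simp only [h4] at h3
  exact h3


lemma aux_inner_real {X : Type*} [MeasurableSpace X] (μ : Measure X)
    (f g : Lp ℂ 2 μ) (p q : X → ℝ) (hf : f =ᵐ[μ] fun x => (p x : ℂ))
    (hg : g =ᵐ[μ] fun x => (q x : ℂ)) :
    inner ℂ f g = ((∫ x, p x * q x ∂μ : ℝ) : ℂ) := by
  rw [L2.inner_def, ← integral_complex_ofReal]
  refine integral_congr_ae ?_
  filter_upwards [hf, hg] with x h1 h2
  rw [h1, h2]
  simp [mul_comm]

lemma aux_norm_real {X : Type*} [MeasurableSpace X] (μ : Measure X)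
    (f : Lp ℂ 2 μ) (p : X → ℝ) (hf : f =ᵐ[μ] fun x => (p x : ℂ)) :
    ‖f‖ ^ 2 = ∫ x, p x * p x ∂μ := by
  rw [← inner_self_eq_norm_sq (𝕜 := ℂ), aux_inner_real μ f f p p hf hf]
  simp

lemma aux_iterT {X : Type*} [MeasurableSpace X] (μ : Measure X)
    (φ : X → X) (hφ : MeasurePreserving φ μ μ)
    (T : Lp ℂ 2 μ →L[ℂ] Lp ℂ 2 μ)
    (hT : ∀ f : Lp ℂ 2 μ, (T f : X → ℂ) =ᵐ[μ] (f : X → ℂ) ∘ φ) (k : ℕ) (f : Lp ℂ 2 μ) (p : X → ℝ)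
    (hf : f =ᵐ[μ] fun x => (p x : ℂ)) :
    (T^[k] f : X → ℂ) =ᵐ[μ] fun x => (p (φ^[k] x) : ℂ) := by
  induction k with
  | zero => exact hf
  | succ k ih =>
    rw [Function.iterate_succ_apply']
    have h1 := hφ.quasiMeasurePreserving.ae_eq_comp ih
    refine (hT _).trans (h1.trans ?_)
    exact Filter.Eventually.of_forall fun x => by simp

lemma aux_iso {X : Type*} [MeasurableSpace X] (μ : Measure X)
    (φ : X → X) (hφ : MeasurePreserving φ μ μ)
    (T : Lp ℂ 2 μ →L[ℂ] Lp ℂ 2 μ)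
    (hT : ∀ f : Lp ℂ 2 μ, (T f : X → ℂ) =ᵐ[μ] (f : X → ℂ) ∘ φ) (f g : Lp ℂ 2 μ) :
    inner ℂ (T f) (T g) = inner ℂ f g := by
  rw [L2.inner_def, L2.inner_def]
  have h1 : ∫ x, inner ℂ ((T f : X → ℂ) x) ((T g : X → ℂ) x) ∂μ
      = ∫ x, (fun y => inner ℂ ((f : X → ℂ) y) ((g : X → ℂ) y)) (φ x) ∂μ := by
    refine integral_congr_ae ?_
    filter_upwards [hT f, hT g] with x h1 h2
    rw [h1, h2]; rfl
  rw [h1, ← integral_map (f := fun y => inner ℂ ((f : X → ℂ) y) ((g : X → ℂ) y)) hφ.measurable.aemeasurable, hφ.map_eq]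
  rw [hφ.map_eq]
  exact (Lp.aestronglyMeasurable f).inner (Lp.aestronglyMeasurable g)

lemma aux_core {X : Type*} [m0 : MeasurableSpace X] (μ : Measure X) [IsProbabilityMeasure μ]
    (φ : X → X) (hφ : MeasurePreserving φ μ μ)
    (T : Lp ℂ 2 μ →L[ℂ] Lp ℂ 2 μ)
    (hT : ∀ f : Lp ℂ 2 μ, (T f : X → ℂ) =ᵐ[μ] (f : X → ℂ) ∘ φ)
    (P : (X → ℝ) → Prop) (hPm : ∀ f g, P f → P g → P (fun x => f x * g x)) (w : X → ℝ) (hw : Measurable w)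
    (hb : ∀ x, |w x| ≤ 1) (hwF : ∀ k : ℕ, P (fun x => w (φ^[k+1] x)))
    (horth : ∀ g : X → ℝ, P g → (∀ x, |g x| ≤ 1) → ∫ x, w x * g x ∂μ = 0)
    (hne : ¬ w =ᵐ[μ] 0) :
    ∀ C : ℝ, ∃ ω : Finset (Lp ℂ 2 μ), C < haprω (⇑T) (ω : Set (Lp ℂ 2 μ)) := by
  intro C
  have hiso := aux_iso μ φ hφ T hT
  have hφk : ∀ k, Measurable (φ^[k]) := fun k => hφ.measurable.iterate k
  have hmem : ∀ p : X → ℝ, Measurable p → (∀ x, |p x| ≤ 1) → MemLp (fun x => (p x : ℂ)) 2 μ := by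
    intro p hp hpb
    refine MemLp.of_bound (by fun_prop) 1 (Filter.Eventually.of_forall fun x => ?_)
    simpa using hpb x
  have hmb : ∀ a b : ℝ, |a| ≤ 1 → |b| ≤ 1 → |a * b| ≤ 1 := fun a b ha hb => by
    rw [abs_mul]; exact mul_le_one₀ ha (abs_nonneg _) hb
  let p : ℕ → X → ℝ := fun j x => w x * w (φ^[j+1] x)
  have hpm : ∀ j, Measurable (p j) := fun j => hw.mul (hw.comp (hφk _))
  have hpb : ∀ j x, |p j x| ≤ 1 := fun j x => hmb _ _ (hb _) (hb _)
  let u : ℕ → Lp ℂ 2 μ := fun j => (hmem (p j) (hpm j) (hpb j)).toLp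
  have hu : ∀ j, u j =ᵐ[μ] fun x => (p j x : ℂ) := fun j => MemLp.coeFn_toLp _
  let v : Lp ℂ 2 μ := (hmem w hw hb).toLp
  have hv : v =ᵐ[μ] fun x => (w x : ℂ) := MemLp.coeFn_toLp _
  have hiter := aux_iterT μ φ hφ T hT
  have huo : ∀ i j k, inner ℂ (u i) (T^[k+1] (u j)) = 0 := by
    intro i j k
    rw [aux_inner_real μ _ _ _ _ (hu i) (hiter (k+1) _ _ (hu j))]
    have h1 : ∫ x, p i x * p j (φ^[k+1] x) ∂μ
      = ∫ x, w x * (w (φ^[i+1] x) * (w (φ^[k+1] x) * w (φ^[(j+1+k)+1] x))) ∂μ := by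
      refine integral_congr_ae (Filter.Eventually.of_forall fun x => ?_)
      simp only [p]
      rw [← Function.iterate_add_apply]
      rw [show j + 1 + (k + 1) = j + 1 + k + 1 by ring]
      ring
    rw [h1, horth _ (hPm _ _ (hwF i) (hPm _ _ (hwF k) (hwF (j+1+k))))
      (fun x => hmb _ _ (hb _) (hmb _ _ (hb _) (hb _)))]
    simp
  let V : Submodule ℂ (Lp ℂ 2 μ) := Submodule.span ℂ (Set.range u)
  have hVo : ∀ k, ∀ x ∈ V, ∀ y ∈ V, inner ℂ x (T^[k+1] y) = 0 := by
    intro k x hx y hy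
    rw [← FunLike.coe_pow_eq_iterate]
    induction hx using Submodule.span_induction with
    | zero => simp
    | add a b _ _ ha hb => rw [inner_add_left, ha, hb, add_zero]
    | smul c a _ ha => rw [inner_smul_left, ha, mul_zero]
    | mem a ha =>
      obtain ⟨i, rfl⟩ := ha
      induction hy using Submodule.span_induction with
      | zero => simp
      | add a b _ _ ha hb => rw [map_add, inner_add_right, ha, hb, add_zero]
      | smul c a _ ha => rw [map_smul, inner_smul_right, ha, mul_zero]
      | mem b hb =>
        obtain ⟨j, rfl⟩ := hb
        rw [FunLike.coe_pow_eq_iterate]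
        exact huo i j k
  have hc : 0 < ∫ x, w x * w x ∂μ := by
    have h0 : 0 ≤ ∫ x, w x * w x ∂μ := integral_nonneg fun x => mul_self_nonneg _
    refine lt_of_le_of_ne h0 fun h => hne ?_
    have hint : Integrable (fun x => w x * w x) μ :=
      Integrable.of_bound (by fun_prop) 1 (Filter.Eventually.of_forall fun x => hmb _ _ (hb x) (hb x))
    have := (integral_eq_zero_iff_of_nonneg (fun x => mul_self_nonneg (w x)) hint).1 h.symm
    filter_upwards [this] with x hx
    simpa using hx
  have hinf : ¬ FiniteDimensional ℂ V := by
    intro hfd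
    have hvn : ‖v‖ ^ 2 = ∫ x, w x * w x ∂μ := by
      exact aux_norm_real μ v w hv
    have hvpos : 0 < ‖v‖ := by
      by_contra h
      have : ‖v‖ = 0 := le_antisymm (not_lt.1 h) (norm_nonneg _)
      rw [this] at hvn; norm_num at hvn; linarith
    have hnorm : ∀ k f, ‖T^[k] f‖ = ‖f‖ := by
      intro k f
      have := aux_iter_inner T hiso k f f
      rw [inner_self_eq_norm_sq_to_K, inner_self_eq_norm_sq_to_K] at this
      have h2 : ‖T^[k] f‖ ^ 2 = ‖f‖ ^ 2 := by exact_mod_cast this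
      exact (sq_eq_sq₀ (norm_nonneg _) (norm_nonneg _)).1 h2
    have hvlt : ∀ i j, i < j → inner ℂ (T^[i] v) (T^[j] v) = 0 := by
      intro k l hkl
      obtain ⟨t, rfl⟩ := Nat.exists_eq_add_of_lt hkl
      rw [add_assoc, Function.iterate_add_apply, aux_iter_inner T hiso,
        aux_inner_real μ _ _ _ _ hv (hiter (t+1) _ _ hv), horth _ (hwF t) (fun x => hb _)]
      simp
    have hvo : ∀ i j, i ≠ j → inner ℂ (T^[i] v) (T^[j] v) = 0 := by
      intro i j hij
      rcases lt_or_gt_of_ne hij with h | h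
      · exact hvlt i j h
      · rw [← inner_conj_symm, hvlt j i h, map_zero]
    have hweak : ∀ e : Lp ℂ 2 μ, Filter.Tendsto (fun j => inner ℂ e (u j)) Filter.atTop (nhds 0) := by
      intro e
      have hm : MemLp (fun x => (w x : ℂ) * (e : X → ℂ) x) 2 μ := by
        refine (Lp.memLp e).of_le ?_ (Filter.Eventually.of_forall fun x => ?_)
        · exact AEStronglyMeasurable.mul (by fun_prop) (Lp.aestronglyMeasurable e)
        · rw [norm_mul]
          refine mul_le_of_le_one_left (norm_nonneg _) ?_
          simpa using hb x
      have := aux_ortho (fun j => T^[j] v) ‖v‖ hvpos (fun j => hnorm j v) hvo hm.toLp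
      have h2 := this.comp (Filter.tendsto_add_atTop_nat 1)
      refine h2.congr fun j => ?_
      simp only [Function.comp]
      rw [L2.inner_def, L2.inner_def]
      refine integral_congr_ae ?_
      filter_upwards [hm.coeFn_toLp, hu j, hiter (j+1) _ _ hv] with x h1 h2 h3
      rw [h1, h2, h3]
      simp [p]
      ring
    have hlim := aux_findim V u (fun j => Submodule.subset_span ⟨j, rfl⟩) hweak
    let q : X → ℝ := fun x => w x * w x
    have hq : MemLp (fun x => (q x : ℂ)) 2 μ :=
      hmem q (hw.mul hw) (fun x => hmb _ _ (hb x) (hb x))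
    have h1 : MemLp (fun x => (((fun _ => 1 : X → ℝ) x : ℝ) : ℂ)) 2 μ :=
      hmem (fun _ => 1) measurable_const (fun x => by simp)
    have hqe : hq.toLp =ᵐ[μ] fun x => (q x : ℂ) := MemLp.coeFn_toLp _
    have h1e : h1.toLp =ᵐ[μ] fun x => (((fun _ => 1 : X → ℝ) x : ℝ) : ℂ) := MemLp.coeFn_toLp _
    have hnle : ∀ (f : Lp ℂ 2 μ) (r : X → ℝ), (∀ x, |r x| ≤ 1) → f =ᵐ[μ] (fun x => (r x : ℂ)) → ‖f‖ ≤ 1 := by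
      intro f r hr hf
      have h2 := aux_norm_real μ f r hf
      have h3 : ∫ x, r x * r x ∂μ ≤ 1 := by
        have := norm_integral_le_of_norm_le_const (μ := μ) (f := fun x => r x * r x) (C := 1)
          (Filter.Eventually.of_forall fun x => hmb _ _ (hr x) (hr x))
        simp at this
        exact (abs_le.1 this).2
      nlinarith [norm_nonneg f]
    refine aux_weak (fun j => T^[j] hq.toLp) (∫ x, w x * w x ∂μ) _ (fun j => ?_) hlim
      (fun i j => ?_) h1.toLp (hnle _ _ (fun x => by simp) h1e) hc (fun j => ?_)
    · rw [hnorm]; exact hnle _ q (fun x => hmb _ _ (hb x) (hb x)) hqe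
    · rw [Function.iterate_add_apply, aux_iter_inner T hiso,
        aux_inner_real μ _ _ _ _ hqe (hiter (j+1) _ _ hqe)]
      have h2 := aux_norm_real μ _ _ (hu j)
      rw [h2]
      simp only [RCLike.re_to_complex, Complex.ofReal_re]
      congr 1; ext x; simp only [p, q]; ring
    · rw [aux_inner_real μ _ _ _ _ h1e (hiter j _ _ hqe)]
      simp only [RCLike.re_to_complex, Complex.ofReal_re, one_mul]
      rw [← integral_map (hφk j).aemeasurable (f := q), (hφ.iterate j).map_eq]
      exact (hw.mul hw).aestronglyMeasurable
  obtain ⟨m, hm⟩ := exists_nat_gt (C * (4 / 3))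
  obtain ⟨e, he, heV⟩ := aux_exists_on V hinf m
  obtain ⟨ω, hω⟩ := aux_hapr T hiso m e he (fun i j k => hVo k _ (heV i) _ (heV j))
  exact ⟨ω, by linarith⟩

lemma aux_setInt {X κ : Type*} [MeasurableSpace X] (μ : Measure X) [IsProbabilityMeasure μ]
    (Z : X → κ) (hZ : ∀ c, MeasurableSet (Z ⁻¹' {c})) (f : X → ℝ) (hf : Integrable f μ)
    (S : Finset κ) : ∫ x in Z ⁻¹' (S : Set κ), f x ∂μ = ∑ c ∈ S, ∫ x in Z ⁻¹' {c}, f x ∂μ := by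
  have h1 : Z ⁻¹' (S : Set κ) = ⋃ c ∈ S, Z ⁻¹' {c} := by ext x; simp
  rw [h1, integral_biUnion_finset S (fun c _ => hZ c) ?_ (fun c _ => hf.integrableOn)]
  intro c _ d _ hcd
  exact Disjoint.preimage _ (by simpa using hcd)

lemma aux_setIntComp {X κ : Type*} [MeasurableSpace X] (μ : Measure X) [IsProbabilityMeasure μ]
    (Z : X → κ) (hZ : ∀ c, MeasurableSet (Z ⁻¹' {c})) (h : κ → ℝ) (c : κ) :
    ∫ x in Z ⁻¹' {c}, h (Z x) ∂μ = μ.real (Z ⁻¹' {c}) * h c := by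
  rw [setIntegral_congr_fun (hZ c) (g := fun _ => h c) (fun x hx => by
    simp only [Set.mem_preimage, Set.mem_singleton_iff] at hx
    simp only [hx])]
  simp

lemma aux_integrableComp {X κ : Type*} [Fintype κ] [MeasurableSpace X] (μ : Measure X)
    [IsProbabilityMeasure μ]
    (Z : X → κ) (hZ : ∀ c, MeasurableSet (Z ⁻¹' {c})) (h : κ → ℝ) :
    Integrable (fun x => h (Z x)) μ := by
  let _ : MeasurableSpace κ := ⊤
  have hZm : Measurable Z := by
    intro s _
    have : Z ⁻¹' s = ⋃ c ∈ s, Z ⁻¹' {c} := by ext x; simp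
    rw [this]
    exact MeasurableSet.biUnion s.to_countable fun c _ => hZ c
  have hm : Measurable (fun x => h (Z x)) := (measurable_from_top (f := h)).comp hZm
  refine Integrable.of_bound hm.aestronglyMeasurable (∑ c, |h c|)
    (Filter.Eventually.of_forall fun x => ?_)
  exact Finset.single_le_sum (f := fun c => |h c|) (fun _ _ => abs_nonneg _) (Finset.mem_univ (Z x))

lemma aux_comap_le {X κ : Type*} [Fintype κ] [MeasurableSpace X]
    (Z : X → κ) (hZ : ∀ c, MeasurableSet (Z ⁻¹' {c})) :
    MeasurableSpace.comap Z ⊤ ≤ (inferInstance : MeasurableSpace X) := by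
  rintro _ ⟨s, _, rfl⟩
  have : Z ⁻¹' s = ⋃ c ∈ s, Z ⁻¹' {c} := by ext x; simp
  rw [this]
  exact MeasurableSet.biUnion s.to_countable fun c _ => hZ c

lemma aux_condExp {X κ : Type*} [Fintype κ] [MeasurableSpace X] (μ : Measure X)
    [IsProbabilityMeasure μ]
    (Z : X → κ) (hZ : ∀ c, MeasurableSet (Z ⁻¹' {c})) (A : Set X) (hA : MeasurableSet A) :
    (fun x => μ.real (A ∩ Z ⁻¹' {Z x}) / μ.real (Z ⁻¹' {Z x})) =ᵐ[μ]
      μ[A.indicator (fun _ => (1 : ℝ)) | MeasurableSpace.comap Z ⊤] := by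
  classical
  have hint : Integrable (fun x => μ.real (A ∩ Z ⁻¹' {Z x}) / μ.real (Z ⁻¹' {Z x})) μ :=
    aux_integrableComp μ Z hZ (fun c => μ.real (A ∩ Z ⁻¹' {c}) / μ.real (Z ⁻¹' {c}))
  have hind : Integrable (A.indicator (fun _ => (1 : ℝ))) μ := (integrable_const 1).indicator hA
  refine ae_eq_condExp_of_forall_setIntegral_eq (aux_comap_le Z hZ) hind
    (fun s _ _ => hint.integrableOn) ?_ ?_
  · rintro _ ⟨s, _, rfl⟩ _
    have hs : s = ((s.toFinite.toFinset : Finset κ) : Set κ) := by simp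
    rw [hs, aux_setInt μ Z hZ _ hint, aux_setInt μ Z hZ _ hind]
    refine Finset.sum_congr rfl fun c _ => ?_
    rw [aux_setIntComp μ Z hZ (fun c => μ.real (A ∩ Z ⁻¹' {c}) / μ.real (Z ⁻¹' {c})),
      setIntegral_indicator hA]
    simp only [integral_const, MeasurableSet.univ, measureReal_restrict_apply, Set.univ_inter,
      smul_eq_mul, mul_one]
    rw [Set.inter_comm (Z ⁻¹' {c}) A]
    by_cases hq : μ.real (Z ⁻¹' {c}) = 0
    · have : μ.real (A ∩ Z ⁻¹' {c}) = 0 :=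
        le_antisymm (hq ▸ measureReal_mono Set.inter_subset_right) measureReal_nonneg
      rw [hq, this]; simp
    · field_simp
  · have h1 : Measurable[MeasurableSpace.comap Z ⊤]
        (fun x => μ.real (A ∩ Z ⁻¹' {Z x}) / μ.real (Z ⁻¹' {Z x})) :=
      @Measurable.comp X κ ℝ (MeasurableSpace.comap Z ⊤) ⊤ _
        (fun c => μ.real (A ∩ Z ⁻¹' {c}) / μ.real (Z ⁻¹' {c})) Z
        measurable_from_top (@comap_measurable X κ ⊤ Z)
    exact h1.stronglyMeasurable.aestronglyMeasurable

/-- The word map. -/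
def auxWord {X ι : Type*} (φ : X → X) (a : X → ι) (n : ℕ) (x : X) : Fin n → ι :=
  fun k => a (φ^[(k : ℕ)] x)

/-- Entropy of the word map. -/
noncomputable def auxE {X ι : Type*} [Fintype ι] [MeasurableSpace X] (μ : Measure X)
    (φ : X → X) (a : X → ι) (n : ℕ) : ℝ :=
  ∑ c : Fin n → ι, Real.negMulLog (μ.real (auxWord φ a n ⁻¹' {c}))

lemma aux_word_meas {X ι : Type*} [MeasurableSpace X]
    (φ : X → X) (hφ : Measurable φ) (a : X → ι) (ha : ∀ i, MeasurableSet (a ⁻¹' {i})) (n : ℕ)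
    (c : Fin n → ι) : MeasurableSet (auxWord φ a n ⁻¹' {c}) := by
  have : auxWord φ a n ⁻¹' {c} = ⋂ k : Fin n, φ^[(k : ℕ)] ⁻¹' (a ⁻¹' {c k}) := by
    ext x; simp [auxWord, funext_iff]
  rw [this]
  exact MeasurableSet.iInter fun k => (hφ.iterate k) (ha _)

lemma aux_E_succ {X ι : Type*} [Fintype ι] [MeasurableSpace X] (μ : Measure X)
    [IsProbabilityMeasure μ]
    (φ : X → X) (hφ : MeasurePreserving φ μ μ) (a : X → ι) (ha : ∀ i, MeasurableSet (a ⁻¹' {i}))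
    (n : ℕ) :
    auxE μ φ a (n + 1) - auxE μ φ a n = ∑ i, ∫ x, Real.negMulLog
      (μ.real (a ⁻¹' {i} ∩ (fun y => auxWord φ a n (φ y)) ⁻¹' {auxWord φ a n (φ x)}) /
        μ.real ((fun y => auxWord φ a n (φ y)) ⁻¹' {auxWord φ a n (φ x)})) ∂μ := by
  classical
  set Z : X → (Fin n → ι) := fun y => auxWord φ a n (φ y) with hZd
  have hZ : ∀ c, MeasurableSet (Z ⁻¹' {c}) := fun c =>
    hφ.measurable (aux_word_meas φ hφ.measurable a ha n c)
  have h1 : auxE μ φ a n = ∑ c, Real.negMulLog (μ.real (Z ⁻¹' {c})) := by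
    refine Finset.sum_congr rfl fun c _ => ?_
    have : Z ⁻¹' {c} = φ ⁻¹' (auxWord φ a n ⁻¹' {c}) := rfl
    rw [this, measureReal_def, measureReal_def,
      hφ.measure_preimage (aux_word_meas φ hφ.measurable a ha n c).nullMeasurableSet]
  have h2 : auxE μ φ a (n + 1) = ∑ c, ∑ i, Real.negMulLog (μ.real (a ⁻¹' {i} ∩ Z ⁻¹' {c})) := by
    rw [Finset.sum_comm, ← Fintype.sum_prod_type']
    refine (Fintype.sum_equiv (Fin.consEquiv (fun _ : Fin (n+1) => ι)) _ _ ?_).symm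
    rintro ⟨i, c⟩
    congr 2
    ext x
    simp only [Set.mem_inter_iff, Set.mem_preimage, Set.mem_singleton_iff, hZd, Fin.consEquiv,
      Equiv.coe_fn_mk]
    constructor
    · rintro ⟨h, h'⟩
      funext k
      refine Fin.cases ?_ (fun k => ?_) k
      · simpa [auxWord] using h
      · have := congrFun h' k
        simpa [auxWord] using this
    · intro h
      refine ⟨?_, ?_⟩
      · simpa [auxWord] using congrFun h 0
      · funext k
        simpa [auxWord] using congrFun h k.succ
  have h3 : ∀ i, ∫ x, Real.negMulLog (μ.real (a ⁻¹' {i} ∩ Z ⁻¹' {Z x}) / μ.real (Z ⁻¹' {Z x})) ∂μ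
      = ∑ c, μ.real (Z ⁻¹' {c}) *
        Real.negMulLog (μ.real (a ⁻¹' {i} ∩ Z ⁻¹' {c}) / μ.real (Z ⁻¹' {c})) := by
    intro i
    let h : (Fin n → ι) → ℝ := fun c =>
      Real.negMulLog (μ.real (a ⁻¹' {i} ∩ Z ⁻¹' {c}) / μ.real (Z ⁻¹' {c}))
    have := aux_setInt μ Z hZ (fun x => h (Z x)) (aux_integrableComp μ Z hZ h) Finset.univ
    simp only [aux_setIntComp μ Z hZ h] at this
    simpa using this
  have h4 : ∑ i, ∫ x, Real.negMulLog (μ.real (a ⁻¹' {i} ∩ Z ⁻¹' {Z x}) / μ.real (Z ⁻¹' {Z x})) ∂μ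
      = auxE μ φ a (n + 1) - auxE μ φ a n := by
    simp only [h3]
    rw [h1, h2, Finset.sum_comm, ← Finset.sum_sub_distrib]
    refine Finset.sum_congr rfl fun c _ => ?_
    set q := μ.real (Z ⁻¹' {c}) with hq
    have hsum : ∑ i, μ.real (a ⁻¹' {i} ∩ Z ⁻¹' {c}) = q := by
      have hU : Z ⁻¹' {c} = ⋃ i ∈ (Finset.univ : Finset ι), (a ⁻¹' {i} ∩ Z ⁻¹' {c}) := by
        ext x; simp
      rw [hq]
      conv_rhs => rw [hU]
      rw [measureReal_biUnion_finset]
      · intro i _ j _ hij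
        exact (Disjoint.preimage a (by simpa using hij : Disjoint ({i} : Set ι) {j})).mono
          Set.inter_subset_left Set.inter_subset_left
      · exact fun i _ => (ha i).inter (hZ c)
    by_cases hq0 : q = 0
    · have : ∀ i, μ.real (a ⁻¹' {i} ∩ Z ⁻¹' {c}) = 0 := fun i =>
        le_antisymm (hq0 ▸ measureReal_mono Set.inter_subset_right) measureReal_nonneg
      simp [hq0, this]
    · have h5 : ∀ i, Real.negMulLog (μ.real (a ⁻¹' {i} ∩ Z ⁻¹' {c}))
          = μ.real (a ⁻¹' {i} ∩ Z ⁻¹' {c}) / q * Real.negMulLog q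
            + q * Real.negMulLog (μ.real (a ⁻¹' {i} ∩ Z ⁻¹' {c}) / q) := by
        intro i
        rw [← Real.negMulLog_mul]
        congr 1
        field_simp
      simp only [h5]
      rw [Finset.sum_add_distrib, ← Finset.sum_mul, ← Finset.sum_div, hsum, div_self hq0]
      ring
  exact h4.symm

/-- The filtration of the future. -/
def auxFil {X ι : Type*} [Fintype ι] [MeasurableSpace X]
    (φ : X → X) (hφ : Measurable φ) (a : X → ι) (ha : ∀ i, MeasurableSet (a ⁻¹' {i})) :
    Filtration ℕ (inferInstance : MeasurableSpace X) where
  seq n := MeasurableSpace.comap (fun y => auxWord φ a n (φ y)) ⊤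
  mono' := by
    intro n m hnm
    have : (fun y => auxWord φ a n (φ y))
        = (fun c : Fin m → ι => fun k : Fin n => c (Fin.castLE hnm k)) ∘ fun y => auxWord φ a m (φ y) := by
      funext y k; rfl
    show MeasurableSpace.comap _ ⊤ ≤ MeasurableSpace.comap _ ⊤
    rw [this, ← MeasurableSpace.comap_comp]
    exact MeasurableSpace.comap_mono le_top
  le' n := aux_comap_le _ fun c => hφ (aux_word_meas φ hφ a ha n c)

lemma aux_E_tendsto {X ι : Type*} [Fintype ι] [MeasurableSpace X] (μ : Measure X)
    [IsProbabilityMeasure μ]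
    (φ : X → X) (hφ : MeasurePreserving φ μ μ) (a : X → ι) (ha : ∀ i, MeasurableSet (a ⁻¹' {i}))
    (h : ∀ i, μ[(a ⁻¹' {i}).indicator (fun _ => (1 : ℝ)) | ⨆ n, auxFil φ hφ.measurable a ha n]
      =ᵐ[μ] (a ⁻¹' {i}).indicator (fun _ => (1 : ℝ))) :
    Filter.Tendsto (fun n : ℕ => auxE μ φ a n / n) Filter.atTop (nhds 0) := by
  have hd : Filter.Tendsto (fun n => auxE μ φ a (n + 1) - auxE μ φ a n) Filter.atTop (nhds 0) := by
    simp only [aux_E_succ μ φ hφ a ha]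
    rw [show (0:ℝ) = ∑ i : ι, 0 by simp]
    refine tendsto_finsetSum _ fun i _ => ?_
    rw [show (0:ℝ) = ∫ _ : X, (0:ℝ) ∂μ by simp]
    have hZ : ∀ n c, MeasurableSet ((fun y => auxWord φ a n (φ y)) ⁻¹' {c}) := fun n c =>
      hφ.measurable (aux_word_meas φ hφ.measurable a ha n c)
    obtain ⟨B, hB⟩ := (isCompact_Icc (a := (0:ℝ)) (b := 1)).exists_bound_of_continuousOn
      Real.continuous_negMulLog.continuousOn
    refine tendsto_integral_of_dominated_convergence (fun _ => B) (fun n => ?_)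
      (integrable_const _) (fun n => Filter.Eventually.of_forall fun x => ?_) ?_
    · exact (aux_integrableComp μ (fun y => auxWord φ a n (φ y)) (hZ n) (fun c => Real.negMulLog
        (μ.real (a ⁻¹' {i} ∩ (fun y => auxWord φ a n (φ y)) ⁻¹' {c}) /
        μ.real ((fun y => auxWord φ a n (φ y)) ⁻¹' {c})))).aestronglyMeasurable
    · refine hB _ ⟨by positivity, ?_⟩
      exact div_le_one_of_le₀ (measureReal_mono Set.inter_subset_right) measureReal_nonneg
    · have h1 := tendsto_ae_condExp (μ := μ) (ℱ := auxFil φ hφ.measurable a ha)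
        ((a ⁻¹' {i}).indicator (fun _ => (1 : ℝ)))
      have h2 := ae_all_iff.2 fun n => aux_condExp μ (fun y => auxWord φ a n (φ y)) (hZ n) _ (ha i)
      filter_upwards [h1, h2, h i] with x h1 h2 h3
      rw [h3] at h1
      have h4 : Filter.Tendsto (fun n => μ.real (a ⁻¹' {i} ∩ (fun y => auxWord φ a n (φ y)) ⁻¹' {auxWord φ a n (φ x)}) /
          μ.real ((fun y => auxWord φ a n (φ y)) ⁻¹' {auxWord φ a n (φ x)})) Filter.atTop
          (nhds ((a ⁻¹' {i}).indicator (fun _ => (1 : ℝ)) x)) :=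
        h1.congr fun n => (h2 n).symm
      have h5 := (Real.continuous_negMulLog.tendsto _).comp h4
      have h6 : Real.negMulLog ((a ⁻¹' {i}).indicator (fun _ => (1 : ℝ)) x) = 0 := by
        by_cases hx : x ∈ a ⁻¹' {i} <;> simp [hx]
      rw [h6] at h5
      exact h5
  have h0 : auxE μ φ a 0 = 0 := by
    simp only [auxE, Finset.univ_unique, Finset.sum_singleton]
    have : auxWord φ a 0 ⁻¹' {default} = Set.univ := by
      ext x; simp only [Set.mem_preimage, Set.mem_singleton_iff, Set.mem_univ, iff_true]
      exact Subsingleton.elim _ _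
    simp [this]
  refine hd.cesaro.congr fun n => ?_
  rw [Finset.sum_range_sub, h0, sub_zero, div_eq_inv_mul]

lemma aux_wF {X : Type*} (F A : MeasurableSpace X) (hFA : F ≤ A) (φ : X → X)
    (hφ : @Measurable _ _ F A φ) (w : X → ℝ) (hw : Measurable[A] w) (k : ℕ) :
    Measurable[F] (fun x => w (φ^[k+1] x)) := by
  have h1 : @Measurable _ _ F F φ := fun s hs => hφ (hFA s hs)
  have h2 : @Measurable _ _ F F (φ^[k]) := @Measurable.iterate X F φ h1 k
  have h3 : Measurable[F] (fun x => w (φ x)) := @Measurable.comp X X ℝ F A _ w φ hw hφ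
  have h4 := @Measurable.comp X X ℝ F F _ _ _ h3 h2
  have h5 : (fun x => w (φ^[k+1] x)) = (fun x => w (φ x)) ∘ φ^[k] := by
    funext x; simp [Function.iterate_succ_apply']
  rw [h5]; exact h4

lemma aux_orth {X : Type*} {F : MeasurableSpace X} [m0 : MeasurableSpace X] (μ : Measure X) [IsProbabilityMeasure μ]
    (hF : F ≤ m0) (f : X → ℝ) (hf : Integrable f μ) (g : X → ℝ) (hg : Measurable[F] g)
    (hgb : ∀ x, |g x| ≤ 1) : ∫ x, (f x - (μ[f | F]) x) * g x ∂μ = 0 := by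
  have hg' : Measurable g := hg.mono hF le_rfl
  have hb : ∀ h : X → ℝ, Integrable h μ → Integrable (fun x => h x * g x) μ := fun h hh =>
    hh.mul_bdd (c := 1) hg'.aestronglyMeasurable (Filter.Eventually.of_forall hgb)
  have h1 := condExp_mul_of_stronglyMeasurable_right (m := F) (μ := μ) hg.stronglyMeasurable
    (hb f hf) hf
  have h2 : ∫ x, (μ[f | F]) x * g x ∂μ = ∫ x, f x * g x ∂μ := by
    rw [← integral_condExp hF (f := fun x => f x * g x)]
    exact (integral_congr_ae h1).symm
  simp only [sub_mul]
  rw [integral_sub (hb f hf) (hb _ integrable_condExp), h2, sub_self]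

lemma aux_static {X : Type*} [MeasurableSpace X] (μ : Measure X) (φ : X → X)
    (α : Finset (Set X)) (a : X → {A // A ∈ α}) (ha : ∀ i, a ⁻¹' {i} = (i : Set X)) (n : ℕ) :
    staticEntropy μ (refinePartition φ α n) = auxE μ φ a n := by
  classical
  have hcell : ∀ c : Fin n → {A // A ∈ α},
      (⋂ k : Fin n, φ^[(k : ℕ)] ⁻¹' ((c k : Set X))) = auxWord φ a n ⁻¹' {c} := by
    intro c
    ext x
    simp only [← ha]
    simp [auxWord, funext_iff]
  unfold staticEntropy refinePartition auxE
  simp only [hcell]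
  rw [Finset.sum_image_of_pairwise_eq_zero]
  · rfl
  · intro c _ d _ hcd heq
    have hdis : Disjoint (auxWord φ a n ⁻¹' {c}) (auxWord φ a n ⁻¹' {d}) :=
      Disjoint.preimage _ (by simpa using hcd)
    rw [← heq] at hdis
    have : auxWord φ a n ⁻¹' {c} = ∅ := by simpa using hdis
    rw [this]; simp

/-- Let `(X, Σ, μ)` be a probability space and `φ : X → X` an invertible
measure-preserving map with `h_μ(φ) > 0`. Then `h_apr(T_φ) = ∞`, i.e. the approximation
entropy of the Koopman operator `T_φ` is not bounded by any real number. -/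
theorem stmt14 {X : Type*} [MeasurableSpace X] (μ : Measure X) [IsProbabilityMeasure μ]
    (φ : X → X) (hφ : MeasurePreserving φ μ μ)
    (hinv : ∃ ψ : X → X, MeasurePreserving ψ μ μ ∧
      (∀ᵐ x ∂μ, ψ (φ x) = x) ∧ (∀ᵐ x ∂μ, φ (ψ x) = x))
    (T : Lp ℂ 2 μ →L[ℂ] Lp ℂ 2 μ)
    (hT : ∀ f : Lp ℂ 2 μ, (T f : X → ℂ) =ᵐ[μ] (f : X → ℂ) ∘ φ)
    (hent : 0 < metricEntropy μ φ) :
    ∀ C : ℝ, ∃ ω : Finset (Lp ℂ 2 μ), C < haprω (⇑T) (ω : Set (Lp ℂ 2 μ)) := by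
  
  classical
  unfold metricEntropy at hent
  obtain ⟨α, hα⟩ := lt_iSup_iff.1 hent
  obtain ⟨⟨hαm, hαd, hαc⟩, hpos⟩ := lt_iSup_iff.1 hα
  rw [ENNReal.ofReal_pos] at hpos
  have hex : ∀ x : X, ∃ i : {A // A ∈ α}, x ∈ (i : Set X) := by
    intro x
    have : x ∈ ⋃ A ∈ α, A := by rw [hαc]; trivial
    simp only [Set.mem_iUnion] at this
    obtain ⟨A, hA, hx⟩ := this
    exact ⟨⟨A, hA⟩, hx⟩
  choose a hax using hex
  have ha' : ∀ i, a ⁻¹' {i} = (i : Set X) := by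
    intro i
    ext x
    simp only [Set.mem_preimage, Set.mem_singleton_iff]
    constructor
    · rintro rfl; exact hax x
    · intro hx
      by_contra hne
      have := hαd (a x).2 i.2 (fun h => hne (Subtype.ext h))
      exact Set.disjoint_left.1 this (hax x) hx
  have ha : ∀ i, MeasurableSet (a ⁻¹' {i}) := fun i => by rw [ha']; exact hαm _ i.2
  have hnot : ¬ ∀ i, μ[(a ⁻¹' {i}).indicator (fun _ => (1 : ℝ)) | ⨆ n, auxFil φ hφ.measurable a ha n]
      =ᵐ[μ] (a ⁻¹' {i}).indicator (fun _ => (1 : ℝ)) := by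
    intro h
    have h1 := aux_E_tendsto μ φ hφ a ha h
    have h2 : partitionEntropy μ φ α = 0 := by
      unfold partitionEntropy
      simp only [aux_static μ φ α a ha']
      exact h1.limsup_eq
    linarith
  push Not at hnot
  obtain ⟨i, hi⟩ := hnot
  have hFm0 : (⨆ n, (auxFil φ hφ.measurable a ha n : MeasurableSpace X)) ≤ (inferInstance : MeasurableSpace X) :=
    iSup_le fun n => (auxFil φ hφ.measurable a ha).le n
  have hFA : (⨆ n, (auxFil φ hφ.measurable a ha n : MeasurableSpace X)) ≤
      ⨆ n, MeasurableSpace.comap (auxWord φ a n) ⊤ := by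
    refine iSup_le fun n => le_trans ?_ (le_iSup _ (n + 1))
    have : (fun y => auxWord φ a n (φ y))
        = (fun c : Fin (n+1) → {A // A ∈ α} => fun k : Fin n => c k.succ) ∘ auxWord φ a (n+1) := by
      funext y k; simp [auxWord]
    show MeasurableSpace.comap _ ⊤ ≤ MeasurableSpace.comap _ ⊤
    rw [this, ← MeasurableSpace.comap_comp]
    exact MeasurableSpace.comap_mono le_top
  have hφF : @Measurable _ _ (⨆ n, (auxFil φ hφ.measurable a ha n : MeasurableSpace X))
      (⨆ n, MeasurableSpace.comap (auxWord φ a n) ⊤) φ := by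
    rw [measurable_iff_comap_le, MeasurableSpace.comap_iSup]
    refine iSup_mono fun n => ?_
    rw [MeasurableSpace.comap_comp]
    exact le_rfl
  set f : X → ℝ := (a ⁻¹' {i}).indicator (fun _ => (1 : ℝ)) with hf
  have hfint : Integrable f μ := (integrable_const 1).indicator (ha i)
  have hfA : Measurable[⨆ n, MeasurableSpace.comap (auxWord φ a n) ⊤] f := by
    have hs : MeasurableSet[⨆ n, MeasurableSpace.comap (auxWord φ a n) ⊤] (a ⁻¹' {i}) := by
      refine (le_iSup (fun n => MeasurableSpace.comap (auxWord φ a n) ⊤) 1) _ ?_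
      exact ⟨{c | c 0 = i}, trivial, by ext x; simp [auxWord]⟩
    exact @Measurable.indicator _ _ (_) _ _ _ _ measurable_const hs
  set ce : X → ℝ := μ[f | ⨆ n, auxFil φ hφ.measurable a ha n] with hce
  have hceF : Measurable[⨆ n, (auxFil φ hφ.measurable a ha n : MeasurableSpace X)] ce :=
    stronglyMeasurable_condExp.measurable
  have hf0 : ∀ x, 0 ≤ f x := fun x => Set.indicator_nonneg (fun _ _ => zero_le_one) x
  have hf1 : ∀ x, f x ≤ 1 := fun x => Set.indicator_le_self' (fun _ _ => zero_le_one) x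
  have hc0 : 0 ≤ᵐ[μ] ce := condExp_nonneg (Filter.Eventually.of_forall hf0)
  have hc1 : ce ≤ᵐ[μ] fun _ => (1:ℝ) := by
    have := condExp_mono (m := ⨆ n, (auxFil φ hφ.measurable a ha n : MeasurableSpace X)) hfint
      (integrable_const (1:ℝ)) (Filter.Eventually.of_forall hf1)
    rwa [condExp_const hFm0] at this
  let cl : X → ℝ := fun x => max 0 (min 1 (ce x))
  have hcl : cl =ᵐ[μ] ce := by
    filter_upwards [hc0, hc1] with x h0 h1
    simp only [cl]
    rw [min_eq_right h1]; exact max_eq_right h0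
  have hclF : Measurable[⨆ n, (auxFil φ hφ.measurable a ha n : MeasurableSpace X)] cl :=
    (show Measurable (fun t : ℝ => max 0 (min 1 t)) by fun_prop).comp hceF
  have hwA : Measurable[⨆ n, MeasurableSpace.comap (auxWord φ a n) ⊤] (fun x => f x - cl x) :=
    Measurable.sub hfA (hclF.mono hFA le_rfl)
  have hcl01 : ∀ x, 0 ≤ cl x ∧ cl x ≤ 1 := fun x =>
    ⟨le_max_left _ _, max_le zero_le_one (min_le_left _ _)⟩
  refine aux_core μ φ hφ T hT
    (fun g => Measurable[⨆ n, (auxFil φ hφ.measurable a ha n : MeasurableSpace X)] g)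
    (fun _ _ h1 h2 => Measurable.mul h1 h2) (fun x => f x - cl x) ?_ ?_ ?_ ?_ ?_
  · exact (measurable_const.indicator (ha i)).sub (hclF.mono hFm0 le_rfl)
  · intro x
    rw [abs_le]
    constructor <;> linarith [hf0 x, hf1 x, (hcl01 x).1, (hcl01 x).2]
  · exact fun k => aux_wF _ _ hFA φ hφF _ hwA k
  · intro g hg hgb
    rw [← aux_orth μ hFm0 f hfint g hg hgb]
    refine integral_congr_ae ?_
    filter_upwards [hcl] with x hx
    simp only [hx, hce]
  · intro h
    refine hi ?_
    filter_upwards [h, hcl] with x h1 h2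
    simp only [Pi.zero_apply] at h1
    linarith
end
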